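/- arXiv:1002.1042 — 4 statements merged into one kernel-verified Lean document; each statement's English description precedes it below -/
import Mathlib

section
/- Let E be an open set in ℂⁿ, let D be a bounded open set with closure contained in E, and let f, g : E → ℂⁿ be holomorphic maps such that f(z) ≠ 0 for every z in the boundary ∂D of D, and ‖g(z)‖ < ‖f(z)‖ for every z ∈ ∂D (with respect to the Euclidean norm on ℂⁿ). Then f has a zero in D if and only if f + g has a zero in D. -/
open Metric Set Filter Topology MeasureTheory

section Holomorphic

variable {V W : Type*} [NormedAddCommGroup V] [NormedSpace ℂ V] [NormedAddCommGroup W]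
  [NormedSpace ℂ W] {E : Set V} {f : V → W}

lemma hasDerivAt_comp_add_smul {z v : V} {ζ : ℂ} (h : DifferentiableAt ℂ f (z + ζ • v)) :
    HasDerivAt (fun ζ : ℂ => f (z + ζ • v)) (fderiv ℂ f (z + ζ • v) v) ζ := by
  have h1 : HasDerivAt (fun ζ : ℂ => z + ζ • v) v ζ := by
    simpa using ((hasDerivAt_id ζ).smul_const v).const_add z
  exact h.hasFDerivAt.comp_hasDerivAt ζ h1

variable [FiniteDimensional ℂ V]

lemma continuousOn_fderiv_of_differentiableOn_complex (hf : DifferentiableOn ℂ f E)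
    (hE : IsOpen E) : ContinuousOn (fderiv ℂ f) E := by
  have : ProperSpace V := FiniteDimensional.proper ℂ V
  intro z₀ hz₀
  refine ContinuousAt.continuousWithinAt ?_
  obtain ⟨r₀, hr₀, hr₀E⟩ := Metric.nhds_basis_closedBall.mem_iff.1 (hE.mem_nhds hz₀)
  set r := r₀ / 2 with hr
  have hrpos : 0 < r := by positivity
  have huc : UniformContinuousOn f (closedBall z₀ r₀) :=
    (isCompact_closedBall z₀ r₀).uniformContinuousOn_of_continuous (hf.continuousOn.mono hr₀E)
  rw [Metric.continuousAt_iff]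
  intro ε hε
  obtain ⟨δ, hδ, H⟩ := Metric.uniformContinuousOn_iff.1 huc (ε / 2 * r) (by positivity)
  refine ⟨min δ r, by positivity, fun z hz => ?_⟩
  have hzδ : dist z z₀ < δ := hz.trans_le (min_le_left _ _)
  have hzr : dist z z₀ < r := hz.trans_le (min_le_right _ _)
  suffices ‖fderiv ℂ f z - fderiv ℂ f z₀‖ ≤ ε / 2 by rw [dist_eq_norm]; linarith
  refine ContinuousLinearMap.opNorm_le_bound _ (by positivity) fun v => ?_
  rcases eq_or_ne v 0 with rfl | hv
  · simp
  have hv' : 0 < ‖v‖ := norm_pos_iff.2 hv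
  set R := r / ‖v‖ with hR
  have hRpos : 0 < R := by positivity
  have key : ∀ ζ ∈ closedBall (0 : ℂ) R, ‖ζ • v‖ ≤ r := fun ζ hζ => by
    rw [norm_smul]
    have : ‖ζ‖ ≤ r / ‖v‖ := by simpa using hζ
    rwa [le_div_iff₀ hv'] at this
  have mem : ∀ y, dist y z₀ < r → ∀ ζ ∈ closedBall (0 : ℂ) R, y + ζ • v ∈ closedBall z₀ r₀ := by
    intro y hy ζ hζ
    rw [mem_closedBall, dist_eq_norm]
    rw [dist_eq_norm] at hy
    calc ‖y + ζ • v - z₀‖ = ‖(y - z₀) + ζ • v‖ := by congr 1; abel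
      _ ≤ ‖y - z₀‖ + ‖ζ • v‖ := norm_add_le _ _
      _ ≤ r₀ := by linarith [key ζ hζ]
  have hd : ∀ y, dist y z₀ < r → ∀ ζ ∈ closedBall (0 : ℂ) R,
      HasDerivAt (fun ζ : ℂ => f (y + ζ • v)) (fderiv ℂ f (y + ζ • v) v) ζ := fun y hy ζ hζ =>
    hasDerivAt_comp_add_smul (hf.differentiableAt (hE.mem_nhds (hr₀E (mem y hy ζ hζ))))
  have hz₀r : dist z₀ z₀ < r := by simpa using hrpos
  have hdiff : DifferentiableOn ℂ (fun ζ : ℂ => f (z + ζ • v) - f (z₀ + ζ • v))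
      (closedBall 0 R) := fun ζ hζ =>
    ((hd z hzr ζ hζ).sub (hd z₀ hz₀r ζ hζ)).differentiableAt.differentiableWithinAt
  have h0 : (0 : ℂ) ∈ closedBall (0 : ℂ) R := by simpa using hRpos.le
  have hderiv := ((hd z hzr 0 h0).sub (hd z₀ hz₀r 0 h0)).deriv
  have bound := Complex.norm_deriv_le_of_forall_mem_sphere_norm_le hRpos
    (hdiff.mono closure_ball_subset_closedBall).diffContOnCl (C := ε / 2 * r) (fun ζ hζ => by
      have hζ' := sphere_subset_closedBall hζ
      rw [← dist_eq_norm]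
      refine (H _ (mem z hzr ζ hζ') _ (mem z₀ hz₀r ζ hζ') ?_).le
      simpa using hzδ)
  change ‖deriv ((fun ζ : ℂ => f (z + ζ • v)) - fun ζ : ℂ => f (z₀ + ζ • v)) 0‖ ≤ _ at bound
  rw [hderiv] at bound
  simp only [zero_smul, add_zero] at bound
  calc ‖(fderiv ℂ f z - fderiv ℂ f z₀) v‖ ≤ ε / 2 * r / R := by simpa using bound
    _ = ε / 2 * ‖v‖ := by rw [hR]; field_simp

variable [CompleteSpace W]

lemma differentiableOn_fderiv_apply_complex (hf : DifferentiableOn ℂ f E) (hE : IsOpen E) (v : V) :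
    DifferentiableOn ℂ (fun z => fderiv ℂ f z v) E := by
  have : ProperSpace V := FiniteDimensional.proper ℂ V
  have hc := continuousOn_fderiv_of_differentiableOn_complex hf hE
  intro z₀ hz₀
  refine DifferentiableAt.differentiableWithinAt ?_
  obtain ⟨r₀, hr₀, hr₀E⟩ := Metric.nhds_basis_closedBall.mem_iff.1 (hE.mem_nhds hz₀)
  set r := r₀ / 2 with hr
  have hrpos : 0 < r := by positivity
  set R := r / (‖v‖ + 1) with hR
  have hRpos : 0 < R := by positivity
  have mem : ∀ y ∈ ball z₀ r, ∀ ζ ∈ closedBall (0 : ℂ) R, y + ζ • v ∈ closedBall z₀ r₀ := by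
    intro y hy ζ hζ
    rw [mem_ball, dist_eq_norm] at hy
    rw [mem_closedBall, dist_eq_norm]
    have h1 : ‖ζ‖ ≤ r / (‖v‖ + 1) := by simpa using hζ
    rw [le_div_iff₀ (by positivity)] at h1
    calc ‖y + ζ • v - z₀‖ = ‖(y - z₀) + ζ • v‖ := by congr 1; abel
      _ ≤ ‖y - z₀‖ + ‖ζ • v‖ := norm_add_le _ _
      _ ≤ r₀ := by rw [norm_smul]; nlinarith [norm_nonneg ζ]
  have hfd : ∀ y ∈ ball z₀ r, ∀ ζ ∈ closedBall (0 : ℂ) R, DifferentiableAt ℂ f (y + ζ • v) :=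
    fun y hy ζ hζ => hf.differentiableAt (hE.mem_nhds (hr₀E (mem y hy ζ hζ)))
  have hcm : ∀ θ, circleMap (0 : ℂ) R θ ∈ closedBall (0 : ℂ) R := fun θ =>
    circleMap_mem_closedBall _ hRpos.le θ
  obtain ⟨M, hM⟩ := (isCompact_closedBall z₀ r₀).exists_bound_of_continuousOn (hc.mono hr₀E)
  have hcurve : ∀ y, Continuous fun θ => y + circleMap (0 : ℂ) R θ • v := fun y => by
    have := continuous_circleMap (0 : ℂ) R
    fun_prop
  have hcoef : Continuous fun θ => deriv (circleMap (0 : ℂ) R) θ * (1 / circleMap 0 R θ ^ 2) := by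
    have h1 := continuous_circleMap (0 : ℂ) R
    have h2 : ∀ θ, circleMap (0 : ℂ) R θ ^ 2 ≠ 0 := fun θ =>
      pow_ne_zero _ (circleMap_ne_center hRpos.ne')
    simp only [deriv_circleMap]
    fun_prop (disch := exact h2 _)
  have hFc : ∀ y ∈ ball z₀ r, Continuous fun θ =>
      (deriv (circleMap (0 : ℂ) R) θ * (1 / circleMap 0 R θ ^ 2)) •
        f (y + circleMap (0 : ℂ) R θ • v) := fun y hy =>
    hcoef.smul ((hf.continuousOn.mono hr₀E).comp_continuous (hcurve y)
      fun θ => mem y hy _ (hcm θ))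
  have hF'c : ∀ y ∈ ball z₀ r, Continuous fun θ =>
      (deriv (circleMap (0 : ℂ) R) θ * (1 / circleMap 0 R θ ^ 2)) •
        fderiv ℂ f (y + circleMap (0 : ℂ) R θ • v) := fun y hy =>
    hcoef.smul ((hc.mono hr₀E).comp_continuous (hcurve y) fun θ => mem y hy _ (hcm θ))
  have hz₀r : z₀ ∈ ball z₀ r := mem_ball_self hrpos
  have main := intervalIntegral.hasFDerivAt_integral_of_dominated_of_fderiv_le (𝕜 := ℂ)
    (μ := volume) (a := 0) (b := 2 * Real.pi) (x₀ := z₀) (s := ball z₀ r)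
    (F := fun y θ => (deriv (circleMap (0 : ℂ) R) θ * (1 / circleMap 0 R θ ^ 2)) •
        f (y + circleMap (0 : ℂ) R θ • v))
    (F' := fun y θ => (deriv (circleMap (0 : ℂ) R) θ * (1 / circleMap 0 R θ ^ 2)) •
        fderiv ℂ f (y + circleMap (0 : ℂ) R θ • v))
    (bound := fun θ => ‖deriv (circleMap (0 : ℂ) R) θ * (1 / circleMap 0 R θ ^ 2)‖ * M)
    (ball_mem_nhds z₀ hrpos)
    (by filter_upwards [ball_mem_nhds z₀ hrpos] with y hy using (hFc y hy).aestronglyMeasurable)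
    ((hFc z₀ hz₀r).intervalIntegrable _ _)
    (hF'c z₀ hz₀r).aestronglyMeasurable
    (Eventually.of_forall fun θ _ y hy => by
      rw [norm_smul]
      gcongr
      exact hM _ (mem y hy _ (hcm θ)))
    ((hcoef.norm.mul continuous_const).intervalIntegrable _ _)
    (Eventually.of_forall fun θ _ y hy => by
      refine HasFDerivAt.const_smul ?_ _
      have h1 : HasFDerivAt (fun y => y + circleMap (0 : ℂ) R θ • v)
          (ContinuousLinearMap.id ℂ V) y := (hasFDerivAt_id y).add_const _
      have h2 := (hfd y hy _ (hcm θ)).hasFDerivAt.comp y h1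
      rwa [ContinuousLinearMap.comp_id] at h2)
  have heq : (fun z => fderiv ℂ f z v) =ᶠ[𝓝 z₀] fun y => (2 * Real.pi * Complex.I : ℂ)⁻¹ •
      ∫ θ in (0 : ℝ)..2 * Real.pi, (deriv (circleMap (0 : ℂ) R) θ * (1 / circleMap 0 R θ ^ 2)) •
        f (y + circleMap (0 : ℂ) R θ • v) := by
    filter_upwards [ball_mem_nhds z₀ hrpos] with y hy
    have hd : DifferentiableOn ℂ (fun ζ : ℂ => f (y + ζ • v)) (closedBall 0 R) := fun ζ hζ =>
      (hasDerivAt_comp_add_smul (hfd y hy ζ hζ)).differentiableAt.differentiableWithinAt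
    have h1 := hd.deriv_eq_smul_circleIntegral hRpos
    have h0 : (0 : ℂ) ∈ closedBall (0 : ℂ) R := by simpa using hRpos.le
    rw [(hasDerivAt_comp_add_smul (hfd y hy 0 h0)).deriv] at h1
    rw [eq_inv_smul_iff₀ Complex.two_pi_I_ne_zero]
    simp only [zero_smul, add_zero] at h1
    rw [← h1, circleIntegral]
    simp only [sub_zero, smul_smul]
  exact (main.differentiableAt.const_smul _).congr_of_eventuallyEq heq

theorem contDiffOn_of_differentiableOn_complex (hE : IsOpen E) (m : ℕ) :
    ∀ {f : V → W}, DifferentiableOn ℂ f E → ContDiffOn ℂ m f E := by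
  induction m with
  | zero => exact fun hf => contDiffOn_zero.2 hf.continuousOn
  | succ m ih =>
    intro f hf
    rw [Nat.cast_succ, contDiffOn_succ_iff_fderiv_of_isOpen hE]
    exact ⟨hf, by simp, contDiffOn_clm_apply.2 fun v =>
      ih (differentiableOn_fderiv_apply_complex hf hE v)⟩

end Holomorphic

section Piola

variable {ι : Type*} [Fintype ι] [DecidableEq ι]

lemma AlternatingMap.sum_update_update_single_eq_zero (D : (ι → ℝ) [⋀^ι]→ₗ[ℝ] ℝ) (m : ι → ι → ℝ)
    {a b : ι} (hab : a ≠ b) (H : ι → ι → ℝ) (hH : ∀ j l, H j l = H l j) :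
    ∑ j, D (Function.update (Function.update m a (Pi.single j 1)) b (H j)) = 0 := by
  set B : ι → ι → ℝ := fun j l =>
    D (Function.update (Function.update m a (Pi.single j 1)) b (Pi.single l 1)) with hB
  have hanti : ∀ j l, B j l = - B l j := fun j l => by
    simp only [hB]
    rw [← D.map_swap _ hab]
    congr 1
    funext i
    simp only [Function.comp_apply, Function.update_apply, Equiv.swap_apply_def]
    split_ifs <;> simp_all
  have hexp : ∀ j, D (Function.update (Function.update m a (Pi.single j 1)) b (H j))
      = ∑ l, H j l * B j l := fun j => by
    conv_lhs => rw [pi_eq_sum_univ' (H j)]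
    rw [AlternatingMap.map_update_sum]
    refine Finset.sum_congr rfl fun l _ => ?_
    rw [AlternatingMap.map_update_smul, smul_eq_mul]
  simp_rw [hexp]
  have h2 : ∑ j, ∑ l, H j l * B j l = - ∑ j, ∑ l, H j l * B j l := by
    conv_lhs => rw [Finset.sum_comm]
    rw [← Finset.sum_neg_distrib]
    refine Finset.sum_congr rfl fun j _ => ?_
    rw [← Finset.sum_neg_distrib]
    refine Finset.sum_congr rfl fun l _ => ?_
    rw [hanti, hH]; ring
  linarith

/-- The determinant as a continuous multilinear map of the rows. -/
noncomputable def detRowContinuousMultilinear (ι : Type*) [Fintype ι] [DecidableEq ι] :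
    ContinuousMultilinearMap ℝ (fun _ : ι => ι → ℝ) ℝ where
  toMultilinearMap := (Matrix.detRowAlternating (n := ι) (R := ℝ)).toMultilinearMap
  cont := by
    change Continuous fun M : Matrix ι ι ℝ => M.det
    exact continuous_id.matrix_det

lemma detRowContinuousMultilinear_apply (M : ι → ι → ℝ) :
    detRowContinuousMultilinear ι M = Matrix.detRowAlternating M := rfl

variable {W : Type*} [NormedAddCommGroup W] [NormedSpace ℝ W]

/-- The gradient of `u` in the directions `e`. -/
noncomputable def gradAlong (e : ι → W) (u : W → ℝ) (x : W) : ι → ℝ := fun l => fderiv ℝ u x (e l)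

/-- The matrix with rows the gradients of the `u i`, except for the row `a` which is `q` times the
`j`-th unit vector. -/
noncomputable def cofactorField (e : ι → W) (u : ι → W → ℝ) (a : ι) (q : W → ℝ) (j : ι) (x : W) :
    ℝ :=
  Matrix.detRowAlternating (Function.update (fun i => gradAlong e (u i) x) a (Pi.single j (q x)))

lemma contDiff_gradAlong {ι : Type*} [Fintype ι] {e : ι → W} {u : W → ℝ} (hu : ContDiff ℝ 2 u) :
    ContDiff ℝ 1 (gradAlong e u) :=
  contDiff_pi.2 fun _ => (hu.fderiv_right (m := 1) (by norm_num)).clm_apply contDiff_const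

lemma contDiff_cofactorField {e : ι → W} {u : ι → W → ℝ} (hu : ∀ i, ContDiff ℝ 2 (u i)) (a : ι)
    {q : W → ℝ} (hq : ContDiff ℝ 1 q) (j : ι) : ContDiff ℝ 1 (cofactorField e u a q j) := by
  refine (detRowContinuousMultilinear ι).contDiff.comp (contDiff_pi.2 fun i => ?_)
  rcases eq_or_ne i a with rfl | hi
  · simp only [Function.update_self]
    exact (ContinuousLinearMap.single ℝ (fun _ : ι => ℝ) j).contDiff.comp hq
  · simp only [Function.update_of_ne hi]
    exact contDiff_gradAlong (hu i)

lemma sum_fderiv_cofactorField_eq_zero {e : ι → W} {u : ι → W → ℝ}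
    (hu : ∀ i, ContDiff ℝ 2 (u i)) (a : ι) {q : W → ℝ} (hq : ContDiff ℝ 1 q) (x : W)
    (hdet : Matrix.detRowAlternating
      (Function.update (fun i => gradAlong e (u i) x) a (gradAlong e q x)) = 0) :
    ∑ j, fderiv ℝ (cofactorField e u a q j) x (e j) = 0 := by
  set M : ι → ι → ℝ := fun i => gradAlong e (u i) x with hM
  have hrow : ∀ j i, HasFDerivAt
      (fun y => Function.update (fun i => gradAlong e (u i) y) a (Pi.single j (q y)) i)
      (if i = a then (ContinuousLinearMap.single ℝ (fun _ : ι => ℝ) j) ∘L fderiv ℝ q x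
        else fderiv ℝ (gradAlong e (u i)) x) x := by
    intro j i
    split_ifs with hi
    · subst hi
      simp only [Function.update_self]
      exact (ContinuousLinearMap.single ℝ (fun _ : ι => ℝ) j).hasFDerivAt.comp x
        (hq.differentiable one_ne_zero x).hasFDerivAt
    · simp only [Function.update_of_ne hi]
      exact ((contDiff_gradAlong (hu i)).differentiable one_ne_zero x).hasFDerivAt
  have hder : ∀ j, fderiv ℝ (cofactorField e u a q j) x (e j) = ∑ i,
      Matrix.detRowAlternating (Function.update (Function.update M a (Pi.single j (q x))) i
        (if i = a then Pi.single j (gradAlong e q x j)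
          else fderiv ℝ (gradAlong e (u i)) x (e j))) := by
    intro j
    have := HasFDerivAt.multilinear_comp (detRowContinuousMultilinear ι) (hrow j)
    have h2 : fderiv ℝ (cofactorField e u a q j) x = _ := this.fderiv
    rw [h2, _root_.sum_apply]
    refine Finset.sum_congr rfl fun i _ => ?_
    rw [ContinuousLinearMap.comp_apply, ContinuousMultilinearMap.toContinuousLinearMap_apply,
      detRowContinuousMultilinear_apply]
    congr 2
    split_ifs <;> rfl
  simp_rw [hder]
  rw [Finset.sum_comm]
  refine Finset.sum_eq_zero fun i _ => ?_
  rcases eq_or_ne i a with rfl | hi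
  · simp only [if_true, Function.update_idem]
    rw [← AlternatingMap.map_update_sum, Finset.univ_sum_single]
    exact hdet
  · simp only [if_neg hi]
    have hH : ∀ j, fderiv ℝ (gradAlong e (u i)) x (e j)
        = fun l => fderiv ℝ (fderiv ℝ (u i)) x (e j) (e l) := by
      intro j
      funext l
      have h1 : HasFDerivAt (fderiv ℝ (u i)) (fderiv ℝ (fderiv ℝ (u i)) x) x :=
        (((hu i).fderiv_right (m := 1) (by norm_num)).differentiable one_ne_zero x).hasFDerivAt
      have h2 : HasFDerivAt (gradAlong e (u i))
          (ContinuousLinearMap.pi fun l =>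
            (ContinuousLinearMap.apply ℝ ℝ (e l)) ∘L fderiv ℝ (fderiv ℝ (u i)) x) x :=
        hasFDerivAt_pi.2 fun l =>
          (ContinuousLinearMap.apply ℝ ℝ (e l)).hasFDerivAt.comp x h1
      rw [h2.fderiv]
      rfl
    have hsymm : IsSymmSndFDerivAt ℝ (u i) x :=
      (hu i).contDiffAt.isSymmSndFDerivAt (by simp)
    have hq1 : ∀ j, (Pi.single j (q x) : ι → ℝ) = q x • Pi.single j 1 := fun j => by
      rw [← Pi.single_smul]; simp
    have key := AlternatingMap.sum_update_update_single_eq_zero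
      (Matrix.detRowAlternating (n := ι) (R := ℝ)) M hi.symm
      (fun j l => fderiv ℝ (fderiv ℝ (u i)) x (e j) (e l)) (fun j l => hsymm _ _)
    calc _ = ∑ j, q x • Matrix.detRowAlternating (Function.update (Function.update M a
          (Pi.single j 1)) i (fun l => fderiv ℝ (fderiv ℝ (u i)) x (e j) (e l))) := by
          refine Finset.sum_congr rfl fun j _ => ?_
          rw [hH, hq1, Function.update_comm hi.symm, AlternatingMap.map_update_smul,
            Function.update_comm hi.symm]
      _ = 0 := by rw [← Finset.smul_sum, key, smul_zero]

end Piola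

section Degree

variable {V : Type*} [NormedAddCommGroup V] [NormedSpace ℝ V] [FiniteDimensional ℝ V]
  [MeasurableSpace V] [BorelSpace V] (μ : Measure V) [μ.IsAddHaarMeasure]

lemma integral_fderiv_apply_eq_zero {F : V → ℝ} (hF : ContDiff ℝ 1 F) (hs : HasCompactSupport F)
    (v : V) : ∫ z, fderiv ℝ F z v ∂μ = 0 := by
  have hc : Continuous fun z => fderiv ℝ F z v :=
    (hF.continuous_fderiv one_ne_zero).clm_apply continuous_const
  have := integral_mul_fderiv_eq_neg_fderiv_mul_of_integrable (μ := μ) (f := fun _ : V => (1 : ℝ))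
    (g := F) (v := v) (by simp)
    (by simpa using hc.integrable_of_hasCompactSupport (hs.fderiv_apply (𝕜 := ℝ) v))
    (by simpa using hF.continuous.integrable_of_hasCompactSupport hs)
    (fun _ _ => differentiableAt_const _) (fun x _ => hF.differentiable one_ne_zero x)
  simpa using this

lemma integral_eq_of_fderiv_add_sum_eq_zero {ι : Type*} [Fintype ι] {K : Set V} (hK : IsCompact K)
    {G : ℝ × V → ℝ} {F : ι → ℝ × V → ℝ} (v : ι → V) (hG : ContDiff ℝ 1 G)
    (hF : ∀ i, ContDiff ℝ 1 (F i)) (hGK : ∀ t, ∀ z ∉ K, G (t, z) = 0)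
    (hFK : ∀ i t, ∀ z ∉ K, F i (t, z) = 0)
    (hdiv : ∀ x, fderiv ℝ G x (1, 0) + ∑ i, fderiv ℝ (F i) x (0, v i) = 0) (s t : ℝ) :
    ∫ z, G (s, z) ∂μ = ∫ z, G (t, z) ∂μ := by
  have hGc : Continuous fun x => fderiv ℝ G x (1, 0) :=
    (hG.continuous_fderiv one_ne_zero).clm_apply continuous_const
  have hGt : ∀ t z, HasDerivAt (fun t => G (t, z)) (fderiv ℝ G (t, z) (1, 0)) t := fun t z =>
    (hG.differentiable one_ne_zero (t, z)).hasFDerivAt.comp_hasDerivAt t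
      ((hasDerivAt_id t).prodMk (hasDerivAt_const t z))
  have hFz : ∀ i t z, HasFDerivAt (fun z => F i (t, z))
      (fderiv ℝ (F i) (t, z) ∘L ContinuousLinearMap.inr ℝ ℝ V) z := fun i t z =>
    (hF i).differentiable one_ne_zero (t, z) |>.hasFDerivAt.comp z (hasFDerivAt_prodMk_right t z)
  have hGt0 : ∀ t, ∀ z ∉ K, fderiv ℝ G (t, z) (1, 0) = 0 := fun t z hz => by
    rw [← (hGt t z).deriv]
    simp [hGK _ z hz]
  have hFint : ∀ i t, ∫ z, fderiv ℝ (F i) (t, z) (0, v i) ∂μ = 0 := fun i t => by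
    have h1 : ContDiff ℝ 1 fun z => F i (t, z) := (hF i).comp (contDiff_const.prodMk contDiff_id)
    have h2 := integral_fderiv_apply_eq_zero μ h1
      (HasCompactSupport.intro hK fun z hz => hFK i t z hz) (v i)
    refine (integral_congr_ae (Eventually.of_forall fun z => ?_)).trans h2
    simp [(hFz i t z).fderiv]
  have hFi : ∀ i t, Integrable (fun z => fderiv ℝ (F i) (t, z) (0, v i)) μ := fun i t => by
    have h1 : ContDiff ℝ 1 fun z => F i (t, z) := (hF i).comp (contDiff_const.prodMk contDiff_id)
    have hcs : HasCompactSupport fun z => F i (t, z) :=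
      HasCompactSupport.intro hK fun z hz => hFK i t z hz
    have := ((h1.continuous_fderiv one_ne_zero).clm_apply
      continuous_const).integrable_of_hasCompactSupport (μ := μ) (hcs.fderiv_apply (𝕜 := ℝ) (v i))
    refine this.congr (Eventually.of_forall fun z => ?_)
    simp [(hFz i t z).fderiv]
  have hder : ∀ t₀, HasDerivAt (fun t => ∫ z, G (t, z) ∂μ) 0 t₀ := by
    intro t₀
    obtain ⟨C, hC⟩ := ((isCompact_closedBall t₀ 1).prod hK).exists_bound_of_continuousOn
      hGc.continuousOn
    have hcont : ∀ t, Continuous fun z => G (t, z) := fun t =>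
      hG.continuous.comp (by fun_prop)
    have main := hasDerivAt_integral_of_dominated_loc_of_deriv_le (μ := μ) (x₀ := t₀)
      (F := fun t z => G (t, z)) (F' := fun t z => fderiv ℝ G (t, z) (1, 0))
      (bound := K.indicator fun _ => C) (closedBall_mem_nhds t₀ one_pos)
      (Eventually.of_forall fun t => (hcont t).aestronglyMeasurable)
      ((hcont t₀).integrable_of_hasCompactSupport
        (HasCompactSupport.intro hK fun z hz => hGK t₀ z hz))
      (hGc.comp (by fun_prop : Continuous fun z : V => (t₀, z))).aestronglyMeasurable
      (Eventually.of_forall fun z t ht => by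
        by_cases hz : z ∈ K
        · rw [indicator_of_mem hz]
          exact hC (t, z) ⟨ht, hz⟩
        · rw [indicator_of_notMem hz, hGt0 t z hz, norm_zero])
      ((integrable_indicator_iff hK.measurableSet).2 (integrableOn_const hK.measure_lt_top.ne))
      (Eventually.of_forall fun z t _ => hGt t z)
    suffices hz : ∫ z, fderiv ℝ G (t₀, z) (1, 0) ∂μ = 0 from hz ▸ main.2
    have : ∀ z, fderiv ℝ G (t₀, z) (1, 0) = - ∑ i, fderiv ℝ (F i) (t₀, z) (0, v i) := fun z =>
      eq_neg_of_add_eq_zero_left (hdiv (t₀, z))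
    simp_rw [this]
    rw [integral_neg, integral_finsetSum _ fun i _ => hFi i t₀]
    simp [hFint]
  exact is_const_of_deriv_eq_zero (fun t => (hder t).differentiableAt) (fun t => (hder t).deriv) s t

theorem setIntegral_comp_mul_det_fderiv_eq {h : ℝ × V → V} (hh : ContDiff ℝ 2 h) {φ : V → ℝ}
    (hφ : ContDiff ℝ 1 φ) {D : Set V} (hD : IsOpen D) (hDb : Bornology.IsBounded D)
    (hb : ∀ t, ∀ z ∈ frontier D, h (t, z) ∉ tsupport φ) (s t : ℝ) :
    ∫ z in D, φ (h (s, z)) * (fderiv ℝ (fun z => h (s, z)) z).det ∂μ =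
      ∫ z in D, φ (h (t, z)) * (fderiv ℝ (fun z => h (t, z)) z).det ∂μ := by
  classical
  have : ProperSpace V := FiniteDimensional.proper ℝ V
  let N := Module.finrank ℝ V
  let b : Module.Basis (Fin N) ℝ V := Module.finBasis ℝ V
  let ℓ : Fin N → V →L[ℝ] ℝ := fun i => (b.coord i).toContinuousLinearMap
  let e : Fin (N + 1) → ℝ × V := Fin.cons (1, 0) fun i => (0, b i)
  let u : Fin (N + 1) → ℝ × V → ℝ := Fin.cons (fun _ => 0) fun i x => ℓ i (h x)
  let q : ℝ × V → ℝ := (univ ×ˢ D).indicator (φ ∘ h)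
  have hu : ∀ i, ContDiff ℝ 2 (u i) := fun i => by
    refine Fin.cases ?_ (fun i => ?_) i
    · exact contDiff_const
    · exact (ℓ i).contDiff.comp hh
  have hφh : ContDiff ℝ 1 (φ ∘ h) := hφ.comp (hh.of_le (by norm_num))
  have hloc : ∀ x, q =ᶠ[𝓝 x] φ ∘ h ∨ q =ᶠ[𝓝 x] 0 := by
    rintro ⟨t, z⟩
    by_cases hz : z ∈ D
    · left
      filter_upwards [(isOpen_univ.prod hD).mem_nhds (show (t, z) ∈ univ ×ˢ D from ⟨trivial, hz⟩)]
        with y hy using indicator_of_mem hy _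
    · right
      by_cases hz' : z ∈ frontier D
      · have : (tsupport φ)ᶜ ∈ 𝓝 (h (t, z)) :=
          (isClosed_tsupport φ).isOpen_compl.mem_nhds (hb t z hz')
        filter_upwards [hh.continuous.continuousAt this] with y hy
        simp only [q, indicator_apply, Function.comp_apply, Pi.zero_apply,
          image_eq_zero_of_notMem_tsupport hy, ite_self]
      · have hz'' : z ∉ closure D := fun h => hz' (by rw [hD.frontier_eq]; exact ⟨h, hz⟩)
        filter_upwards [(isOpen_univ.prod isClosed_closure.isOpen_compl).mem_nhds
          (show (t, z) ∈ univ ×ˢ (closure D)ᶜ from ⟨trivial, hz''⟩)] with y hy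
        exact indicator_of_notMem (fun h => hy.2 (subset_closure h.2)) _
  have hq : ContDiff ℝ 1 q := contDiff_iff_contDiffAt.2 fun x => by
    rcases hloc x with h1 | h1
    · exact hφh.contDiffAt.congr_of_eventuallyEq h1
    · exact contDiffAt_const.congr_of_eventuallyEq h1
  have hdet : ∀ x, Matrix.detRowAlternating
      (Function.update (fun i => gradAlong e (u i) x) 0 (gradAlong e q x)) = 0 := by
    intro x
    rcases hloc x with h1 | h1
    · have hd : HasFDerivAt h (fderiv ℝ h x) x := (hh.differentiable two_ne_zero x).hasFDerivAt
      have h2 : gradAlong e q x =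
          ∑ i : Fin N, fderiv ℝ φ (h x) (b i) • gradAlong e (u i.succ) x := by
        funext l
        have h3 : fderiv ℝ q x = fderiv ℝ φ (h x) ∘L fderiv ℝ h x :=
          h1.fderiv_eq.trans
            (((hφ.differentiable one_ne_zero (h x)).hasFDerivAt.comp x hd).fderiv)
        have h4 : ∀ i : Fin N, fderiv ℝ (u i.succ) x = ℓ i ∘L fderiv ℝ h x := fun i =>
          ((ℓ i).hasFDerivAt.comp x hd).fderiv
        simp only [gradAlong, h3, h4, Finset.sum_apply, Pi.smul_apply, smul_eq_mul,
          ContinuousLinearMap.comp_apply]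
        conv_lhs => rw [← b.sum_repr (fderiv ℝ h x (e l))]
        rw [map_sum]
        refine Finset.sum_congr rfl fun i _ => ?_
        rw [map_smul, smul_eq_mul, mul_comm]
        rfl
      rw [h2, AlternatingMap.map_update_sum]
      refine Finset.sum_eq_zero fun i _ => ?_
      rw [AlternatingMap.map_update_smul,
        AlternatingMap.map_eq_zero_of_eq _ _ _ (Fin.succ_ne_zero i), smul_zero]
      rw [Function.update_of_ne (Fin.succ_ne_zero i), Function.update_self]
    · have : gradAlong e q x = 0 := by
        funext l
        simp [gradAlong, h1.fderiv_eq]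
      rw [this, AlternatingMap.map_update_zero]
  have hdiv := fun x => sum_fderiv_cofactorField_eq_zero hu 0 hq x (hdet x)
  have hzero : ∀ j t, ∀ z ∉ closure D, cofactorField e u 0 q j (t, z) = 0 := fun j t z hz => by
    have : q (t, z) = 0 := indicator_of_notMem (fun h => hz (subset_closure h.2)) _
    rw [cofactorField, this, Pi.single_zero, AlternatingMap.map_update_zero]
  have hint := integral_eq_of_fderiv_add_sum_eq_zero μ hDb.isCompact_closure
    (G := cofactorField e u 0 q 0) (F := fun i : Fin N => cofactorField e u 0 q i.succ)
    b (contDiff_cofactorField hu 0 hq 0) (fun i => contDiff_cofactorField hu 0 hq _)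
    (hzero 0) (fun i => hzero _) (fun x => (Fin.sum_univ_succ _).symm.trans (hdiv x)) s t
  have heq : ∀ t z, cofactorField e u 0 q 0 (t, z) =
      D.indicator (fun z => φ (h (t, z)) * (fderiv ℝ (fun z => h (t, z)) z).det) z := by
    intro t z
    have hA : HasFDerivAt (fun z => h (t, z))
        (fderiv ℝ h (t, z) ∘L ContinuousLinearMap.inr ℝ ℝ V) z :=
      (hh.differentiable two_ne_zero (t, z)).hasFDerivAt.comp z (hasFDerivAt_prodMk_right t z)
    have h1 : cofactorField e u 0 q 0 (t, z) =
        q (t, z) * (fderiv ℝ (fun z => h (t, z)) z).det := by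
      change Matrix.det (Matrix.of (Function.update (fun i => gradAlong e (u i) (t, z)) 0
        (Pi.single 0 (q (t, z))))) = _
      rw [Matrix.det_succ_row_zero, Finset.sum_eq_single 0]
      · rw [ContinuousLinearMap.det, ← LinearMap.det_toMatrix b]
        simp only [Fin.val_zero, pow_zero, one_mul, Matrix.of_apply, Function.update_self,
          Pi.single_eq_same]
        congr 2
        ext i l
        have h4 : fderiv ℝ (u i.succ) (t, z) = ℓ i ∘L fderiv ℝ h (t, z) :=
          ((ℓ i).hasFDerivAt.comp (t, z)
            (hh.differentiable two_ne_zero (t, z)).hasFDerivAt).fderiv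
        rw [LinearMap.toMatrix_apply, hA.fderiv]
        simp only [Matrix.submatrix_apply, Matrix.of_apply, Fin.zero_succAbove,
          Function.update_of_ne (Fin.succ_ne_zero i), gradAlong, h4]
        rfl
      · intro j _ hj
        simp [Function.update_self, Pi.single_eq_of_ne hj]
      · simp
    rw [h1]
    by_cases hz : z ∈ D
    · rw [indicator_of_mem hz]
      congr 1
      exact indicator_of_mem (show (t, z) ∈ univ ×ˢ D from ⟨trivial, hz⟩) _
    · rw [indicator_of_notMem hz]
      have : q (t, z) = 0 := indicator_of_notMem (fun h => hz h.2) _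
      rw [this, zero_mul]
  simp_rw [heq, integral_indicator hD.measurableSet] at hint
  exact hint

end Degree

section Rouche

variable {V : Type*} [NormedAddCommGroup V] [NormedSpace ℂ V] [FiniteDimensional ℂ V]

lemma det_restrictScalars_eq_normSq (A : V →L[ℂ] V) :
    (A.restrictScalars ℝ).det = Complex.normSq A.det := by
  rw [← Algebra.norm_complex_apply]
  exact LinearMap.det_restrictScalars (R := ℝ) (f := (A : V →ₗ[ℂ] V))

lemma exists_det_add_smul_id_ne_zero (A : V →L[ℂ] V) {r : ℝ} (hr : 0 < r) :
    ∃ ε : ℝ, 0 < ε ∧ ε < r ∧ (A + (ε : ℂ) • ContinuousLinearMap.id ℂ V).det ≠ 0 := by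
  have hfin : {ε : ℝ | (-(ε : ℂ)) ∈ (A : V →ₗ[ℂ] V).charpoly.rootSet ℂ}.Finite :=
    (Polynomial.rootSet_finite _ ℂ).preimage
      (neg_injective.comp Complex.ofReal_injective).injOn
  obtain ⟨ε, hε, hεn⟩ := (Set.Ioo_infinite hr).exists_notMem_finite hfin
  refine ⟨ε, hε.1, hε.2, fun h0 => hεn ?_⟩
  rw [Set.mem_ofPred_eq, Polynomial.mem_rootSet]
  refine ⟨(LinearMap.charpoly_monic _).ne_zero, ?_⟩
  rw [Polynomial.coe_aeval_eq_eval, LinearMap.eval_charpoly]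
  have : algebraMap ℂ (Module.End ℂ V) (-(ε : ℂ)) - (A : V →ₗ[ℂ] V) =
      (-1 : ℂ) • ((A + (ε : ℂ) • ContinuousLinearMap.id ℂ V : V →L[ℂ] V) : V →ₗ[ℂ] V) := by
    ext v
    simp [Algebra.algebraMap_eq_smul_one]
    abel
  rw [this, LinearMap.det_smul]
  exact mul_eq_zero_of_right _ h0

lemma exists_contDiff_eventuallyEq {E K : Set V} (hE : IsOpen E) (hK : IsClosed K) (hKE : K ⊆ E)
    {f : V → V} (hf : DifferentiableOn ℂ f E) :
    ∃ F : V → V, ContDiff ℝ 2 F ∧ ∀ z ∈ K, F =ᶠ[𝓝 z] f := by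
  have : FiniteDimensional ℝ V := FiniteDimensional.complexToReal V
  obtain ⟨χ, h0, h1, -⟩ := exists_contMDiffMap_zero_one_nhds_of_isClosed (n := 2)
    (modelWithCornersSelf ℝ V) hE.isClosed_compl hK (disjoint_compl_left_iff_subset.2 hKE)
  have hχ : ContDiff ℝ 2 χ := χ.contMDiff.contDiff
  have hfc : ContDiffOn ℝ 2 f E :=
    (contDiffOn_of_differentiableOn_complex hE 2 hf).restrict_scalars ℝ
  refine ⟨fun z => χ z • f z, contDiff_iff_contDiffAt.2 fun z => ?_, fun z hz => ?_⟩
  · by_cases hz : z ∈ E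
    · exact hχ.contDiffAt.smul (hfc.contDiffAt (hE.mem_nhds hz))
    · refine contDiffAt_const (c := (0 : V)) |>.congr_of_eventuallyEq ?_
      filter_upwards [h0.filter_mono (nhds_le_nhdsSet hz)] with y hy
      rw [hy, zero_smul]
  · filter_upwards [h1.filter_mono (nhds_le_nhdsSet hz)] with y hy
    rw [hy, one_smul]

theorem exists_zero_of_forall_homotopy_ne_zero {E D : Set V} (hE : IsOpen E) (hD : IsOpen D)
    (hDb : Bornology.IsBounded D) (hDE : closure D ⊆ E) {f g : V → V}
    (hf : DifferentiableOn ℂ f E) (hg : DifferentiableOn ℂ g E)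
    (hne : ∀ s ∈ Icc (0 : ℝ) 1, ∀ z ∈ frontier D, f z + s • g z ≠ 0) (hz : ∃ z ∈ D, f z = 0) :
    ∃ z ∈ D, f z + g z = 0 := by
  have : FiniteDimensional ℝ V := FiniteDimensional.complexToReal V
  have : ProperSpace V := FiniteDimensional.proper ℝ V
  borelize V
  let μ : Measure V := Measure.addHaar
  by_contra! hno
  obtain ⟨p, hpD, hp⟩ := hz
  obtain ⟨F, hF, hFf⟩ := exists_contDiff_eventuallyEq hE isClosed_closure hDE hf
  obtain ⟨G, hG, hGg⟩ := exists_contDiff_eventuallyEq hE isClosed_closure hDE hg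
  have hFc := hF.continuous
  have hGc := hG.continuous
  have hfr : frontier D ⊆ closure D := frontier_subset_closure
  obtain ⟨m, hm, hmle⟩ := (isCompact_Icc.prod (hDb.isCompact_closure.of_isClosed_subset
    isClosed_frontier hfr)).exists_forall_le' (f := fun x : ℝ × V => ‖F x.2 + x.1 • G x.2‖)
    (a := 0) (by fun_prop) (fun x hx => by
      rw [norm_pos_iff, (hFf _ (hfr hx.2)).self_of_nhds, (hGg _ (hfr hx.2)).self_of_nhds]
      exact hne _ hx.1 _ hx.2)
  obtain ⟨c, hc, hcle⟩ := hDb.isCompact_closure.exists_forall_le'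
    (f := fun z : V => ‖F z + G z‖) (a := 0) (by fun_prop) (fun z hz => by
      rw [norm_pos_iff, (hFf _ hz).self_of_nhds, (hGg _ hz).self_of_nhds]
      by_cases hzD : z ∈ D
      · exact hno z hzD
      · have := hne 1 (by simp) z (by rw [hD.frontier_eq]; exact ⟨hz, hzD⟩)
        rwa [one_smul] at this)
  obtain ⟨R, hR, hRle⟩ := hDb.closure.subset_closedBall_lt 0 p
  set δ := min m c with hδ
  have hδpos : 0 < δ := lt_min hm hc
  obtain ⟨ε, hε, hεlt, hεdet⟩ := exists_det_add_smul_id_ne_zero (fderiv ℂ f p)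
    (show 0 < δ / (2 * R) by positivity)
  have hεR : ε * R < δ / 2 := by
    rw [lt_div_iff₀ (by positivity)] at hεlt
    linarith
  let σ := Real.smoothTransition
  have hσ : ContDiff ℝ 2 σ := Real.smoothTransition.contDiff
  let h : ℝ × V → V := fun x => F x.2 + ((1 - σ x.1) * ε) • (x.2 - p) + σ x.1 • G x.2
  have hh : ContDiff ℝ 2 h := by
    have h1 : ContDiff ℝ 2 fun x : ℝ × V => σ x.1 := hσ.comp contDiff_fst
    have h2 : ContDiff ℝ 2 fun x : ℝ × V => F x.2 := hF.comp contDiff_snd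
    have h3 : ContDiff ℝ 2 fun x : ℝ × V => G x.2 := hG.comp contDiff_snd
    fun_prop
  let φ : ContDiffBump (0 : V) := ⟨δ / 8, δ / 4, by positivity, by linarith⟩
  have hb : ∀ t, ∀ z ∈ frontier D, h (t, z) ∉ tsupport φ := by
    intro t z hz hmem
    rw [φ.tsupport_eq, mem_closedBall_zero_iff] at hmem
    have h1 : m ≤ ‖F z + σ t • G z‖ :=
      hmle (b := (σ t, z)) ⟨⟨Real.smoothTransition.nonneg t, Real.smoothTransition.le_one t⟩, hz⟩
    have h2 : ‖((1 - σ t) * ε) • (z - p)‖ ≤ ε * R := by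
      have hz' : ‖z - p‖ ≤ R := by simpa [dist_eq_norm] using hRle (hfr hz)
      have h0 := Real.smoothTransition.nonneg t
      have h1 := Real.smoothTransition.le_one t
      rw [norm_smul, Real.norm_of_nonneg (mul_nonneg (by linarith) hε.le)]
      exact mul_le_mul (mul_le_of_le_one_left hε.le (by linarith)) hz' (norm_nonneg _) hε.le
    have h3 : F z + σ t • G z = h (t, z) - ((1 - σ t) * ε) • (z - p) := by
      simp only [h]; abel
    have h4 := norm_sub_le (h (t, z)) (((1 - σ t) * ε) • (z - p))
    rw [← h3] at h4
    have h5 : ‖h (t, z)‖ ≤ δ / 4 := hmem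
    have h6 : δ ≤ m := min_le_left _ _
    linarith
  have key := setIntegral_comp_mul_det_fderiv_eq μ hh (φ := φ) φ.contDiff hD hDb hb 0 1
  have hone : ∀ z, h (1, z) = F z + G z := fun z => by simp [h, σ]
  have hzero : ∀ z, h (0, z) = F z + ε • (z - p) := fun z => by simp [h, σ]
  have hint1 : ∫ z in D, φ (h (1, z)) * (fderiv ℝ (fun z => h (1, z)) z).det ∂μ = 0 := by
    refine setIntegral_eq_zero_of_forall_eq_zero fun z hz => ?_
    rw [φ.zero_of_le_dist, zero_mul]
    have h1 : c ≤ ‖F z + G z‖ := hcle z (subset_closure hz)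
    have h2 : δ ≤ c := min_le_right _ _
    have h3 : φ.rOut = δ / 4 := rfl
    rw [dist_zero_right, hone, h3]
    linarith
  have hcont : Continuous fun z => φ (h (0, z)) * (fderiv ℝ (fun z => h (0, z)) z).det := by
    have h1 : ContDiff ℝ 2 fun z => h (0, z) := hh.comp (contDiff_const.prodMk contDiff_id)
    exact (φ.continuous.comp h1.continuous).mul
      (ContinuousLinearMap.continuous_det.comp (h1.continuous_fderiv two_ne_zero))
  have hdet : ∀ z ∈ D, (fderiv ℝ (fun z => h (0, z)) z).det = Complex.normSq
      (fderiv ℂ f z + (ε : ℂ) • ContinuousLinearMap.id ℂ V).det := by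
    intro z hz
    have hzc := subset_closure hz
    have h1 : HasFDerivAt (fun z => f z + (ε : ℂ) • (z - p))
        (fderiv ℂ f z + (ε : ℂ) • ContinuousLinearMap.id ℂ V) z :=
      (hf.differentiableAt (hE.mem_nhds (hDE hzc))).hasFDerivAt.add
        (((hasFDerivAt_id z).sub_const p).const_smul (ε : ℂ))
    have h2 : (fun z => h (0, z)) =ᶠ[𝓝 z] fun z => f z + (ε : ℂ) • (z - p) := by
      filter_upwards [hFf z hzc] with y hy
      rw [hzero, hy, Complex.coe_smul]
    rw [((h1.restrictScalars ℝ).congr_of_eventuallyEq h2).fderiv, det_restrictScalars_eq_normSq]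
  have hpos : 0 < ∫ z in D, φ (h (0, z)) * (fderiv ℝ (fun z => h (0, z)) z).det ∂μ := by
    rw [setIntegral_pos_iff_support_of_nonneg_ae]
    · refine IsOpen.measure_pos μ (hcont.isOpen_support.inter hD) ⟨p, ?_, hpD⟩
      rw [Function.mem_support, hdet p hpD, hzero, (hFf p (subset_closure hpD)).self_of_nhds, hp]
      have : φ 0 = 1 := φ.one_of_mem_closedBall (by simpa using φ.rIn_pos.le)
      simpa [this] using hεdet
    · refine (ae_restrict_iff' hD.measurableSet).2 (Eventually.of_forall fun z hz => ?_)
      simp only [Pi.zero_apply, hdet z hz]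
      exact mul_nonneg φ.nonneg (Complex.normSq_nonneg _)
    · exact (hcont.continuousOn.integrableOn_compact hDb.isCompact_closure).mono_set subset_closure
  rw [key, hint1] at hpos
  exact lt_irrefl _ hpos

end Rouche

/-- Multidimensional Rouché theorem (Aizenberg–Yuzhakov), existence form:
if `f, g` are holomorphic on an open set `E ⊆ ℂⁿ`, `D` is a bounded open set with
closure contained in `E`, `f` does not vanish on `∂D`, and `‖g‖ < ‖f‖` on `∂D`,
then `f` has a zero in `D` iff `f + g` has a zero in `D`. -/
theorem rouche_existence
    (n : ℕ) (E D : Set (EuclideanSpace ℂ (Fin n)))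
    (hE : IsOpen E) (hD : IsOpen D)
    (hDbdd : Bornology.IsBounded D) (hDE : closure D ⊆ E)
    (f g : EuclideanSpace ℂ (Fin n) → EuclideanSpace ℂ (Fin n))
    (hf : DifferentiableOn ℂ f E) (hg : DifferentiableOn ℂ g E)
    (hfne : ∀ z ∈ frontier D, f z ≠ 0)
    (hlt : ∀ z ∈ frontier D, ‖g z‖ < ‖f z‖) :
    (∃ z ∈ D, f z = 0) ↔ (∃ z ∈ D, f z + g z = 0) := by
  have hne : ∀ s : ℝ, 0 ≤ s → s ≤ 1 → ∀ z ∈ frontier D, f z + s • g z ≠ 0 := by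
    intro s hs0 hs1 z hz h0
    have h1 : ‖f z‖ = s * ‖g z‖ := by
      rw [eq_neg_of_add_eq_zero_left h0, norm_neg, norm_smul, Real.norm_of_nonneg hs0]
    have h2 : s * ‖g z‖ ≤ ‖g z‖ := mul_le_of_le_one_left (norm_nonneg _) hs1
    linarith [hlt z hz]
  constructor
  · exact exists_zero_of_forall_homotopy_ne_zero hE hD hDbdd hDE hf hg
      fun s hs => hne s hs.1 hs.2
  · intro h
    obtain ⟨z, hz, hz0⟩ := exists_zero_of_forall_homotopy_ne_zero hE hD hDbdd hDE
      (f := fun z => f z + g z) (g := fun z => -g z) (hf.add hg) hg.neg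
      (fun s hs z hz h0 => hne (1 - s) (by linarith [hs.2]) (by linarith [hs.1]) z hz (by
        rw [← h0, sub_smul, one_smul, smul_neg]; abel)) h
    exact ⟨z, hz, by simpa using hz0⟩
end

section
/- Let S ⊆ ℂ² be open and let χ₂, χ₋₂ : S → ℂ be (2,3)-homogeneous of weight 5/2. Suppose (a*, b*) ∈ S satisfies χ₂(a*, b*) = iπ(2n − 1) and χ₋₂(a*, b*) = iπ(2m − 1) for positive integers n, m. Then for every natural number k, the point (a_k, b_k) = ((2k+1)^{4/5}·a*, (2k+1)^{6/5}·b*) lies in S and satisfies χ₂(a_k, b_k) = iπ(2k+1)(2n − 1) and χ₋₂(a_k, b_k) = iπ(2k+1)(2m − 1); moreover (2k+1)(2n−1) and (2k+1)(2m−1) are odd positive integers, so (a_k, b_k) again satisfies equations of the form χ₂ = iπ(2n'−1), χ₋₂ = iπ(2m'−1) with positive integers n', m'. -/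
lemma exists_pos_odd_mul_odd (k n : ℕ) (hn : 0 < n) :
    ∃ n' : ℕ, 0 < n' ∧ ((2*k+1) * (2*n - 1) : ℤ) = 2 * n' - 1 := by
  obtain ⟨j, rfl⟩ := Nat.exists_eq_succ_of_ne_zero hn.ne'
  refine ⟨2 * k * j + k + j + 1, by omega, ?_⟩
  push_cast
  ring


/-- Every solution of the Bohr–Sommerfeld–Boutroux system generates a sequence of
descendant solutions: if `χ₂, χneg2` are (2,3)-homogeneous of weight 5/2 on `S` and
`(a*, b*) ∈ S` satisfies `χ₂ = iπ(2n−1)`, `χneg2 = iπ(2m−1)`, then for every `k ∈ ℕ`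
the point `((2k+1)^{4/5} a*, (2k+1)^{6/5} b*)` lies in `S`, satisfies
`χ₂ = iπ(2k+1)(2n−1)`, `χneg2 = iπ(2k+1)(2m−1)`, and these are again of the form
`iπ(2n'−1)`, `iπ(2m'−1)` with positive integers `n', m'`. -/
theorem descendant_solutions
    (S : Set (ℂ × ℂ)) (hS : IsOpen S)
    (χ₂ χneg2 : ℂ × ℂ → ℂ)
    (hmem : ∀ x : ℝ, 0 < x → ∀ p ∈ S, ((x:ℂ)^2 * p.1, (x:ℂ)^3 * p.2) ∈ S)
    (hhom₂ : ∀ x : ℝ, 0 < x → ∀ p ∈ S,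
      χ₂ ((x:ℂ)^2 * p.1, (x:ℂ)^3 * p.2) = ((x ^ ((5:ℝ)/2) : ℝ) : ℂ) * χ₂ p)
    (hhomneg2 : ∀ x : ℝ, 0 < x → ∀ p ∈ S,
      χneg2 ((x:ℂ)^2 * p.1, (x:ℂ)^3 * p.2) = ((x ^ ((5:ℝ)/2) : ℝ) : ℂ) * χneg2 p)
    (astar bstar : ℂ) (hstar : (astar, bstar) ∈ S)
    (n m : ℕ) (hn : 0 < n) (hm : 0 < m)
    (hq₂ : χ₂ (astar, bstar) = Complex.I * Real.pi * (2 * (n:ℂ) - 1))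
    (hqneg2 : χneg2 (astar, bstar) = Complex.I * Real.pi * (2 * (m:ℂ) - 1)) :
    ∀ k : ℕ,
      ((((2*(k:ℝ)+1) ^ ((4:ℝ)/5) : ℝ) : ℂ) * astar,
        (((2*(k:ℝ)+1) ^ ((6:ℝ)/5) : ℝ) : ℂ) * bstar) ∈ S ∧
      χ₂ ((((2*(k:ℝ)+1) ^ ((4:ℝ)/5) : ℝ) : ℂ) * astar,
          (((2*(k:ℝ)+1) ^ ((6:ℝ)/5) : ℝ) : ℂ) * bstar)
        = Complex.I * Real.pi * ((2*(k:ℂ)+1) * (2 * (n:ℂ) - 1)) ∧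
      χneg2 ((((2*(k:ℝ)+1) ^ ((4:ℝ)/5) : ℝ) : ℂ) * astar,
          (((2*(k:ℝ)+1) ^ ((6:ℝ)/5) : ℝ) : ℂ) * bstar)
        = Complex.I * Real.pi * ((2*(k:ℂ)+1) * (2 * (m:ℂ) - 1)) ∧
      ∃ n' m' : ℕ, 0 < n' ∧ 0 < m' ∧
        ((2*k+1) * (2*n - 1) : ℤ) = 2 * n' - 1 ∧
        ((2*k+1) * (2*m - 1) : ℤ) = 2 * m' - 1 := by
  intro k
  have ht : (0:ℝ) < 2 * (k:ℝ) + 1 := by positivity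
  set x : ℝ := (2 * (k:ℝ) + 1) ^ ((2:ℝ)/5) with hx
  have hx0 : 0 < x := Real.rpow_pos_of_pos ht _
  have h2 : (2 * (k:ℝ) + 1) ^ ((4:ℝ)/5) = x ^ 2 := by
    rw [hx, ← Real.rpow_mul_natCast ht.le]; norm_num
  have h3 : (2 * (k:ℝ) + 1) ^ ((6:ℝ)/5) = x ^ 3 := by
    rw [hx, ← Real.rpow_mul_natCast ht.le]; norm_num
  have h5 : x ^ ((5:ℝ)/2) = 2 * (k:ℝ) + 1 := by
    rw [hx, ← Real.rpow_mul ht.le]; norm_num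
  obtain ⟨n', hn', hnn'⟩ := exists_pos_odd_mul_odd k n hn
  obtain ⟨m', hm', hmm'⟩ := exists_pos_odd_mul_odd k m hm
  rw [h2, h3, Complex.ofReal_pow, Complex.ofReal_pow]
  refine ⟨hmem x hx0 _ hstar, ?_, ?_, n', m', hn', hm', hnn', hmm'⟩
  · rw [hhom₂ x hx0 _ hstar, h5, hq₂]
    push_cast
    ring
  · rw [hhomneg2 x hx0 _ hstar, h5, hqneg2]
    push_cast
    ring
end

section
/- Let S ⊆ ℂ² be open and let χ : S → ℂ be holomorphic and (2,3)-homogeneous of weight 5/2. Suppose (a*, b*) ∈ S satisfies χ(a*, b*) = iπ(2n − 1) for a positive integer n, and set c = (∂χ/∂a)(a*, b*), d = (∂χ/∂b)(a*, b*). Fix z, w ∈ ℂ and real numbers α > 1/5, β > −1/5, and set γ = 2·min(α − 1/5, β + 1/5) > 0. Then for all sufficiently large k ∈ ℕ the point ((2k+1)^{4/5}·a* + (2k+1)^{−α}·z, (2k+1)^{6/5}·b* + (2k+1)^{−β}·w) lies in S, and as k → ∞ one has −exp(χ((2k+1)^{4/5}·a* + (2k+1)^{−α}·z, (2k+1)^{6/5}·b*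 + (2k+1)^{−β}·w)) = 1 + c·(2k+1)^{1/5−α}·z + d·(2k+1)^{−1/5−β}·w + O((2k+1)^{−γ}). -/
open Asymptotics Filter Topology

/-- The first-order Taylor remainder of a complex differentiable function is quadratic. -/
theorem DifferentiableOn.isBigO_sub_fderiv_sq {E F : Type*}
    [NormedAddCommGroup E] [NormedSpace ℂ E] [NormedAddCommGroup F] [NormedSpace ℂ F]
    {f : E → F} {s : Set E} {p : E} (hf : DifferentiableOn ℂ f s) (hs : s ∈ 𝓝 p) :
    (fun q ↦ f q - f p - fderiv ℂ f p (q - p)) =O[𝓝 p] fun q ↦ ‖q - p‖ ^ 2 := by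
  have hfp : DifferentiableAt ℂ f p := hf.differentiableAt hs
  set g : E → F := fun q ↦ f q - fderiv ℂ f p (q - p) with hg
  have hgc : ContinuousAt g p := by
    have := hfp.continuousAt
    fun_prop
  obtain ⟨r, hr, hball⟩ := Metric.mem_nhds_iff.1
    (inter_mem hs (hgc.preimage_mem_nhds (Metric.closedBall_mem_nhds (g p) one_pos)))
  have hgd : DifferentiableOn ℂ g (Metric.ball p r) := by
    have := hf.mono fun q hq ↦ (hball hq).1
    fun_prop
  have hgo : (g · - g p) =o[𝓝 p] fun q ↦ ‖q - p‖ ^ 1 := by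
    have := hfp.hasFDerivAt.isLittleO
    simpa [hg, sub_right_comm] using this.norm_right
  refine IsBigO.of_bound (1 / r ^ 2) ?_
  filter_upwards [Metric.ball_mem_nhds p hr] with q hq
  have := Complex.dist_le_mul_div_pow_of_mapsTo_ball_of_isLittleO hgd
    (fun q hq ↦ (hball hq).2) hgo hq
  simp only [hg, dist_eq_norm, sub_self, map_zero, sub_zero, one_mul, Nat.reduceAdd, div_pow] at this
  rw [sub_right_comm]
  simpa [div_eq_inv_mul] using this

theorem Complex.exp_odd_mul_pi_mul_I (m : ℤ) :
    Complex.exp ((2 * m + 1) * (Real.pi * Complex.I)) = -1 := by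
  rw [show (2 * (m : ℂ) + 1) * (Real.pi * Complex.I)
    = m * (2 * Real.pi * Complex.I) + Real.pi * Complex.I by ring, Complex.exp_add,
    Complex.exp_int_mul_two_pi_mul_I, Complex.exp_pi_mul_I, one_mul]

/-- Linearization lemma: if `χ` is holomorphic and (2,3)-homogeneous of weight 5/2 on
`S`, and `χ(a*,b*) = iπ(2n−1)`, then for `c = ∂_a χ(a*,b*)`, `d = ∂_b χ(a*,b*)`,
fixed `z, w ∈ ℂ` and `α > 1/5`, `β > −1/5`, `γ = 2 min(α−1/5, β+1/5)`, the point
`((2k+1)^{4/5}a* + (2k+1)^{−α}z, (2k+1)^{6/5}b* + (2k+1)^{−β}w)` lies in `S` for all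
large `k` and
`−e^{χ(·)} = 1 + c(2k+1)^{1/5−α}z + d(2k+1)^{−1/5−β}w + O((2k+1)^{−γ})`. -/
theorem linearization_lemma
    (S : Set (ℂ × ℂ)) (hS : IsOpen S)
    (χ : ℂ × ℂ → ℂ) (hχ : DifferentiableOn ℂ χ S)
    (hmem : ∀ x : ℝ, 0 < x → ∀ p ∈ S, ((x:ℂ)^2 * p.1, (x:ℂ)^3 * p.2) ∈ S)
    (hhom : ∀ x : ℝ, 0 < x → ∀ p ∈ S,
      χ ((x:ℂ)^2 * p.1, (x:ℂ)^3 * p.2) = ((x ^ ((5:ℝ)/2) : ℝ) : ℂ) * χ p)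
    (astar bstar : ℂ) (hstar : (astar, bstar) ∈ S)
    (n : ℕ) (hn : 0 < n)
    (hq : χ (astar, bstar) = Complex.I * Real.pi * (2 * (n:ℂ) - 1))
    (c d : ℂ)
    (hc : c = deriv (fun a : ℂ => χ (a, bstar)) astar)
    (hd : d = deriv (fun b : ℂ => χ (astar, b)) bstar)
    (z w : ℂ) (α β γ : ℝ) (hα : 1/5 < α) (hβ : -(1/5) < β)
    (hγ : γ = 2 * min (α - 1/5) (β + 1/5)) :
    ∃ (K : ℕ) (Cst : ℝ), ∀ k : ℕ, K ≤ k →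
      ((((2*(k:ℝ)+1) ^ ((4:ℝ)/5) : ℝ) : ℂ) * astar + (((2*(k:ℝ)+1) ^ (-α) : ℝ) : ℂ) * z,
        (((2*(k:ℝ)+1) ^ ((6:ℝ)/5) : ℝ) : ℂ) * bstar + (((2*(k:ℝ)+1) ^ (-β) : ℝ) : ℂ) * w) ∈ S ∧
      ‖-Complex.exp (χ
          ((((2*(k:ℝ)+1) ^ ((4:ℝ)/5) : ℝ) : ℂ) * astar + (((2*(k:ℝ)+1) ^ (-α) : ℝ) : ℂ) * z,
            (((2*(k:ℝ)+1) ^ ((6:ℝ)/5) : ℝ) : ℂ) * bstar + (((2*(k:ℝ)+1) ^ (-β) : ℝ) : ℂ) * w))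
        - (1 + c * (((2*(k:ℝ)+1) ^ (1/5 - α) : ℝ) : ℂ) * z
             + d * (((2*(k:ℝ)+1) ^ (-(1/5) - β) : ℝ) : ℂ) * w)‖
        ≤ Cst * (2*(k:ℝ)+1) ^ (-γ) := by
  have hS' : S ∈ 𝓝 (astar, bstar) := hS.mem_nhds hstar
  have hdiff : DifferentiableAt ℂ χ (astar, bstar) := hχ.differentiableAt hS'
  set L := fderiv ℂ χ (astar, bstar) with hL
  have hc' : c = L (1, 0) := by
    rw [hc]
    exact (hdiff.hasFDerivAt.comp_hasDerivAt astar
      ((hasDerivAt_id astar).prodMk (hasDerivAt_const astar bstar))).deriv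
  have hd' : d = L (0, 1) := by
    rw [hd]
    exact (hdiff.hasFDerivAt.comp_hasDerivAt bstar
      ((hasDerivAt_const bstar astar).prodMk (hasDerivAt_id bstar))).deriv
  have hLv (u v : ℂ) : L (u, v) = u * c + v * d := by
    rw [hc', hd', ← smul_eq_mul, ← smul_eq_mul, ← map_smul, ← map_smul, ← map_add]
    simp
  set δ := min (α - 1/5) (β + 1/5) with hδ
  have hδ0 : 0 < δ := lt_min (by linarith) (by linarith)
  have hδα : δ ≤ α - 1/5 := min_le_left _ _
  have hδβ : δ ≤ β + 1/5 := min_le_right _ _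
  obtain ⟨C, hC0, hC⟩ := (hχ.isBigO_sub_fderiv_sq hS').exists_pos
  have hCe := hC.bound
  set A := max ‖z‖ ‖w‖
  have hA0 : 0 ≤ A := (norm_nonneg z).trans (le_max_left _ _)
  have hN : Tendsto (fun k : ℕ ↦ 2 * (k : ℝ) + 1) atTop atTop :=
    tendsto_atTop_add_const_right _ _ (tendsto_natCast_atTop_atTop.const_mul_atTop two_pos)
  set q : ℝ → ℂ × ℂ := fun N ↦ (astar + ((N ^ (-α - 4/5) : ℝ) : ℂ) * z,
    bstar + ((N ^ (-β - 6/5) : ℝ) : ℂ) * w) with hqdef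
  have hq0 (N : ℝ) : q N - (astar, bstar) =
      (((N ^ (-α - 4/5) : ℝ) : ℂ) * z, ((N ^ (-β - 6/5) : ℝ) : ℂ) * w) := by
    simp [hqdef]
  have hqn (N : ℝ) (h1 : 1 ≤ N) : ‖q N - (astar, bstar)‖ ≤ A * N ^ (-1 - δ) := by
    have h0 : 0 ≤ N := by linarith
    rw [hq0, Prod.norm_def]
    simp only [norm_mul, Complex.norm_real, Real.norm_eq_abs, abs_of_nonneg (Real.rpow_nonneg h0 _)]
    rw [mul_comm A]
    exact max_le
      (mul_le_mul (Real.rpow_le_rpow_of_exponent_le h1 (by linarith)) (le_max_left _ _)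
        (norm_nonneg _) (Real.rpow_nonneg h0 _))
      (mul_le_mul (Real.rpow_le_rpow_of_exponent_le h1 (by linarith)) (le_max_right _ _)
        (norm_nonneg _) (Real.rpow_nonneg h0 _))
  have hzero (s : ℝ) (hs : 0 < s) (B : ℝ) :
      Tendsto (fun N : ℝ ↦ B * N ^ (-s)) atTop (𝓝 0) := by
    simpa using (tendsto_rpow_neg_atTop hs).const_mul B
  have hqlim : Tendsto q atTop (𝓝 (astar, bstar)) := by
    rw [tendsto_iff_norm_sub_tendsto_zero]
    refine squeeze_zero' (.of_forall fun _ ↦ norm_nonneg _)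
      ((eventually_ge_atTop 1).mono hqn) ?_
    simpa [sub_eq_add_neg, add_comm] using hzero (1 + δ) (by linarith) A
  set B := A * (‖c‖ + ‖d‖) + C * A ^ 2 with hB
  have key : ∀ᶠ N : ℝ in atTop, 1 ≤ N ∧ q N ∈ S ∧
      ‖χ (q N) - χ (astar, bstar) - L (q N - (astar, bstar))‖
        ≤ C * ‖‖q N - (astar, bstar)‖ ^ 2‖ ∧ B * N ^ (-δ) ≤ 1 :=
    (eventually_ge_atTop 1).and <| (hqlim.eventually hS').and <| (hqlim.eventually hCe).and <|
      (hzero δ hδ0 B).eventually (ge_mem_nhds one_pos)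
  obtain ⟨K, hK⟩ := eventually_atTop.1 (hN.eventually key)
  refine ⟨K, B ^ 2 + C * A ^ 2, fun k hk ↦ ?_⟩
  obtain ⟨h1, hqS, hrem, hsmall⟩ := hK k hk
  have hodd : (2 * (k : ℝ) + 1 : ℝ) * χ (astar, bstar)
      = (2 * ((2 * k + 1) * n - k - 1 : ℤ) + 1) * (Real.pi * Complex.I) := by
    rw [hq]; push_cast; ring
  generalize 2 * (k : ℝ) + 1 = N at *
  have h0 : 0 < N := by linarith
  have hx0 : 0 < N ^ ((2:ℝ)/5) := Real.rpow_pos_of_pos h0 _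
  have hx2 : (N ^ ((2:ℝ)/5)) ^ 2 = N ^ ((4:ℝ)/5) := by
    rw [← Real.rpow_mul_natCast h0.le]; norm_num
  have hx3 : (N ^ ((2:ℝ)/5)) ^ 3 = N ^ ((6:ℝ)/5) := by
    rw [← Real.rpow_mul_natCast h0.le]; norm_num
  have hx5 : (N ^ ((2:ℝ)/5)) ^ ((5:ℝ)/2) = N := by
    rw [← Real.rpow_mul h0.le]; norm_num
  have hmul (s t u : ℝ) (h : s + t = u) :
      ((N ^ s : ℝ) : ℂ) * ((N ^ t : ℝ) : ℂ) = ((N ^ u : ℝ) : ℂ) := by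
    rw [← Complex.ofReal_mul, ← Real.rpow_add h0, h]
  have hpt : (((N ^ ((4:ℝ)/5) : ℝ) : ℂ) * astar + ((N ^ (-α) : ℝ) : ℂ) * z,
      ((N ^ ((6:ℝ)/5) : ℝ) : ℂ) * bstar + ((N ^ (-β) : ℝ) : ℂ) * w)
      = (((N ^ ((2:ℝ)/5) : ℝ) : ℂ) ^ 2 * (q N).1, ((N ^ ((2:ℝ)/5) : ℝ) : ℂ) ^ 3 * (q N).2) := by
    rw [← Complex.ofReal_pow, ← Complex.ofReal_pow, hx2, hx3,
      ← hmul (4/5) (-α - 4/5) (-α) (by ring), ← hmul (6/5) (-β - 6/5) (-β) (by ring)]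
    simp only [hqdef, mul_add, mul_assoc]
  rw [hpt]
  refine ⟨hmem _ hx0 _ hqS, ?_⟩
  rw [hhom _ hx0 _ hqS, hx5]
  set ℓ : ℂ := c * ((N ^ (1/5 - α) : ℝ) : ℂ) * z + d * ((N ^ (-(1/5) - β) : ℝ) : ℂ) * w with hℓ
  have hNL : (N : ℂ) * L (q N - (astar, bstar)) = ℓ := by
    have e1 := hmul 1 (-α - 4/5) (1/5 - α) (by ring)
    have e2 := hmul 1 (-β - 6/5) (-(1/5) - β) (by ring)
    rw [Real.rpow_one] at e1 e2
    rw [hq0, hLv, hℓ, ← e1, ← e2]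
    ring
  set R : ℂ := N * (χ (q N) - χ (astar, bstar) - L (q N - (astar, bstar))) with hR
  have hχN : N * χ (q N) = N * χ (astar, bstar) + (ℓ + R) := by
    rw [hR, ← hNL]; ring
  have hsq : (N ^ (-δ)) ^ 2 = N ^ (-γ) := by
    rw [← Real.rpow_mul_natCast h0.le, hγ]; congr 1; push_cast; ring
  have hNδ : N * N ^ (-1 - δ) = N ^ (-δ) := by
    rw [← Real.rpow_one_add' h0.le (by linarith)]; congr 1; ring
  have hδ1 : N ^ (-δ) ≤ 1 := Real.rpow_le_one_of_one_le_of_nonpos h1 (by linarith)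
  have hδp : 0 ≤ N ^ (-δ) := Real.rpow_nonneg h0.le _
  have hRn : ‖R‖ ≤ C * A ^ 2 * N ^ (-γ) := by
    have hN1 : N ^ (-1 - δ) ≤ N ^ (-δ) :=
      Real.rpow_le_rpow_of_exponent_le h1 (by linarith)
    calc ‖R‖ ≤ N * (C * (A * N ^ (-1 - δ)) ^ 2) := by
          rw [hR, norm_mul, Complex.norm_real, Real.norm_of_nonneg h0.le]
          grw [hrem, norm_pow, norm_norm, hqn N h1]
      _ = C * A ^ 2 * ((N * N ^ (-1 - δ)) * N ^ (-1 - δ)) := by ring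
      _ ≤ C * A ^ 2 * (N ^ (-δ) * N ^ (-δ)) := by rw [hNδ]; gcongr
      _ = C * A ^ 2 * N ^ (-γ) := by rw [← hsq]; ring
  have hℓn : ‖ℓ‖ ≤ A * (‖c‖ + ‖d‖) * N ^ (-δ) := by
    have hb1 : N ^ (1/5 - α) ≤ N ^ (-δ) := Real.rpow_le_rpow_of_exponent_le h1 (by linarith)
    have hb2 : N ^ (-(1/5) - β) ≤ N ^ (-δ) := Real.rpow_le_rpow_of_exponent_le h1 (by linarith)
    calc ‖ℓ‖ ≤ ‖c‖ * N ^ (1/5 - α) * ‖z‖ + ‖d‖ * N ^ (-(1/5) - β) * ‖w‖ := by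
          refine (norm_add_le _ _).trans_eq ?_
          simp only [norm_mul, Complex.norm_real, Real.norm_of_nonneg (Real.rpow_nonneg h0.le _)]
      _ ≤ ‖c‖ * N ^ (-δ) * A + ‖d‖ * N ^ (-δ) * A := by
          gcongr
          exacts [le_max_left _ _, le_max_right _ _]
      _ = _ := by ring
  have hu : ‖ℓ + R‖ ≤ B * N ^ (-δ) := by
    refine (norm_add_le _ _).trans ?_
    have : N ^ (-γ) ≤ N ^ (-δ) := by
      rw [← hsq, sq]; exact mul_le_of_le_one_left hδp hδ1
    grw [hℓn, hRn, this, hB]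
    rw [add_mul]
  rw [hχN, Complex.exp_add, hodd, Complex.exp_odd_mul_pi_mul_I]
  calc ‖-(-1 * Complex.exp (ℓ + R)) - (1 + c * ((N ^ (1/5 - α) : ℝ) : ℂ) * z
        + d * ((N ^ (-(1/5) - β) : ℝ) : ℂ) * w)‖
      = ‖(Complex.exp (ℓ + R) - 1 - (ℓ + R)) + R‖ := by rw [hℓ]; congr 1; ring
    _ ≤ (B * N ^ (-δ)) ^ 2 + C * A ^ 2 * N ^ (-γ) := by
        refine (norm_add_le _ _).trans (add_le_add ?_ hRn)
        refine (Complex.norm_exp_sub_one_sub_id_le (hu.trans hsmall)).trans ?_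
        gcongr
    _ = (B ^ 2 + C * A ^ 2) * N ^ (-γ) := by rw [mul_pow, hsq, add_mul]
end

section
/- Fix ε, δ > 0 and real numbers α, β with 1/5 < α < 6/5 and −1/5 < β < 4/5. Let S ⊆ ℂ² be open and let χ₂, χ₋₂ : S → ℂ be holomorphic, (2,3)-homogeneous of weight 5/2, and satisfy (∂χ₂/∂a)·(∂χ₋₂/∂b) − (∂χ₋₂/∂a)·(∂χ₂/∂b) = −28πi at every point of S. Suppose (a*, b*) ∈ S satisfies χ₂(a*, b*) = iπ(2n − 1) and χ₋₂(a*, b*) = iπ(2m − 1) for positive integers n, m, and set (a_k, b_k) = ((2k+1)^{4/5}·a*, (2k+1)^{6/5}·b*) and Ũ = (−e^{χ₂} − 1, −e^{χ₋₂} − 1). Let U be a holomorphic map from an open set E ⊆ ℂ² to ℂ², let C ≥ 0, and assume there is K₀ such that for all k ≥ K₀ the closed polydisc D̄_k = {(a,b) : |a − a_k| ≤ k^{−α}ε, |b − b_k| ≤ k^{−β}δ} is contained in E ∩ S and ‖U(a,b) − Ũ(a,b)‖ ≤ C·(2k+1)^{−1} for all (a,b) ∈ D̄_k. Then there exists K ∈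 ℕ such that for every k ≥ K there is exactly one point (a,b) in the open polydisc {(a,b) : |a − a_k| < k^{−α}ε, |b − b_k| < k^{−β}δ} with U(a,b) = 0. -/
open Metric Set Filter Topology

/-- A bounded holomorphic map on a ball is Lipschitz on the concentric ball of half the radius. -/
theorem Complex.norm_sub_le_of_norm_le_of_mem_ball_half {E F : Type*}
    [NormedAddCommGroup E] [NormedSpace ℂ E] [NormedAddCommGroup F] [NormedSpace ℂ F]
    {f : E → F} {c : E} {ρ M : ℝ} (hf : DifferentiableOn ℂ f (ball c ρ))
    (hM : ∀ w ∈ ball c ρ, ‖f w‖ ≤ M) {x y : E} (hx : x ∈ ball c (ρ / 2))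
    (hy : y ∈ ball c (ρ / 2)) : ‖f x - f y‖ ≤ 4 * M / ρ * ‖x - y‖ := by
  have hρ : 0 < ρ / 2 := pos_of_mem_ball hx
  have hsub : ∀ z ∈ ball c (ρ / 2), ball z (ρ / 2) ⊆ ball c ρ := fun z hz =>
    ball_subset_ball' (by rw [mem_ball] at hz; linarith)
  let _ : NormedSpace ℝ E := NormedSpace.restrictScalars ℝ ℂ E
  refine Convex.norm_image_sub_le_of_norm_fderiv_le (𝕜 := ℂ) (s := ball c (ρ / 2))
    (fun z hz => ?_) (fun z hz => ?_) (convex_ball c (ρ / 2)) hy hx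
  · exact hf.differentiableAt (isOpen_ball.mem_nhds (hsub z hz (mem_ball_self hρ)))
  · refine (Complex.norm_fderiv_le_div_of_mapsTo_ball (R₁ := ρ / 2) (R₂ := 2 * M)
      (hf.mono (hsub z hz)) (fun w hw => ?_) hρ).trans_eq (by field_simp; ring)
    rw [mem_closedBall, dist_eq_norm]
    have h1 := hM w (hsub z hz hw)
    have h2 := hM z (hsub z hz (mem_ball_self hρ))
    exact (norm_sub_le _ _).trans (by linarith)

/-- A holomorphic map that is close to a linear isomorphism `J` on a set `B` containing the ball
`ball 0 ρ` has exactly one zero in `B`. -/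
theorem existsUnique_zero_of_norm_sub_le {E F : Type*}
    [NormedAddCommGroup E] [NormedSpace ℂ E] [CompleteSpace E] [Nontrivial E]
    [NormedAddCommGroup F] [NormedSpace ℂ F]
    (J : E ≃L[ℂ] F) {V : E → F} {B : Set E} {ρ η τ : ℝ} (hρ : 0 < ρ) (hη : 0 ≤ η) (hτ : 0 ≤ τ)
    (hB : ball 0 ρ ⊆ B) (hV : DifferentiableOn ℂ V (ball 0 ρ))
    (hVJ : ∀ w ∈ B, ‖V w - J w‖ ≤ η * ‖w‖ + τ)
    (hηJ : ‖(J.symm : F →L[ℂ] E)‖ * η ≤ 1 / 16)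
    (hτJ : ‖(J.symm : F →L[ℂ] E)‖ * τ ≤ ρ / 64) :
    ∃! w, w ∈ B ∧ V w = 0 := by
  have hN : 0 < ‖(J.symm : F →L[ℂ] E)‖ := J.norm_symm_pos
  set N := ‖(J.symm : F →L[ℂ] E)‖ with hNdef
  have hc0 : 0 ≤ 4 * (η * ρ + τ) / ρ := by positivity
  have hcN : N * (4 * (η * ρ + τ) / ρ) ≤ 5 / 16 := by
    rw [mul_div_assoc', div_le_iff₀ hρ]
    nlinarith
  have happ : ApproximatesLinearOn V (J : E →L[ℂ] F) (ball 0 (ρ / 2))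
      ⟨4 * (η * ρ + τ) / ρ, hc0⟩ := by
    intro x hx y hy
    have h := Complex.norm_sub_le_of_norm_le_of_mem_ball_half (f := fun w => V w - J w)
      (M := η * ρ + τ) (hV.sub J.differentiable.differentiableOn) (fun w hw => by
        refine (hVJ w (hB hw)).trans ?_
        have := mem_ball_zero_iff.1 hw
        gcongr) hx hy
    refine le_of_eq_of_le ?_ h
    simp only [ContinuousLinearEquiv.coe_coe, map_sub]
    congr 1
    abel
  have hcN' : 4 * (η * ρ + τ) / ρ < N⁻¹ := by
    rw [← one_div, lt_div_iff₀ hN]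
    linarith
  have hsmall : ∀ w ∈ B, V w = 0 → w ∈ ball (0 : E) (ρ / 2) := by
    intro w hw hw0
    have h1 := hVJ w hw
    rw [hw0, zero_sub, norm_neg] at h1
    have h2 : ‖w‖ ≤ N * ‖J w‖ := by
      simpa using (J.symm : F →L[ℂ] E).le_opNorm (J w)
    have h3 : ‖w‖ ≤ N * η * ‖w‖ + N * τ := by nlinarith
    rw [mem_ball_zero_iff]
    nlinarith [norm_nonneg w]
  have hball : closedBall (0 : E) (ρ / 4) ⊆ ball 0 (ρ / 2) := closedBall_subset_ball (by linarith)
  have hsurj := happ.surjOn_closedBall_of_nonlinearRightInverse J.toNonlinearRightInverse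
    (by positivity : 0 ≤ ρ / 4) hball
  have h0 : (0 : F) ∈ closedBall (V 0) (((N : ℝ)⁻¹ - 4 * (η * ρ + τ) / ρ) * (ρ / 4)) := by
    have h1 := hVJ 0 (hB (mem_ball_self hρ))
    simp only [map_zero, sub_zero, norm_zero, mul_zero, zero_add] at h1
    rw [mem_closedBall, dist_zero_left]
    refine h1.trans ?_
    rw [← mul_le_mul_iff_right₀ hN]
    calc N * τ ≤ (1 - 5 / 16) * (ρ / 4) := by linarith
      _ ≤ (1 - N * (4 * (η * ρ + τ) / ρ)) * (ρ / 4) := by gcongr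
      _ = _ := by field_simp
  obtain ⟨w, hw, hw0⟩ := hsurj h0
  refine ⟨w, ⟨hB (ball_subset_ball (by linarith) (hball hw)), hw0⟩, fun v ⟨hvB, hv0⟩ => ?_⟩
  exact happ.injOn (Or.inr hcN') (hsmall v hvB hv0) (hball hw) (hv0.trans hw0.symm)

/-- Rescaling a differentiable map vanishing at `0` leaves its linear part unchanged and only
improves the linear approximation, also after composition with a map tangent to the identity. -/
theorem exists_norm_comp_rescale_sub_le {E F : Type*}
    [NormedAddCommGroup E] [NormedSpace ℂ E] [NormedAddCommGroup F] [NormedSpace ℂ F]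
    {G : E → F} {J : E →L[ℂ] F} {Φ : F → F}
    (hG : HasFDerivAt G J 0) (hG0 : G 0 = 0)
    (hΦ : HasFDerivAt Φ (ContinuousLinearMap.id ℂ F) 0) (hΦ0 : Φ 0 = 0) {η : ℝ} (hη : 0 < η) :
    ∃ r > 0, ∀ X : ℝ, 1 ≤ X → ∀ w : E, ‖w‖ < r →
      ‖Φ ((X : ℂ) • G ((X : ℂ)⁻¹ • w)) - J w‖ ≤ η * ‖w‖ := by
  have hL : 0 < ‖J‖ + η / 2 := by positivity
  have h1 := hG.isLittleO.def (half_pos hη)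
  have h2 := hΦ.isLittleO.def (div_pos (half_pos hη) hL)
  simp only [hG0, hΦ0, sub_zero, ContinuousLinearMap.id_apply] at h1 h2
  obtain ⟨r₁, hr₁, h1⟩ := Metric.eventually_nhds_iff_ball.1 h1
  obtain ⟨r₂, hr₂, h2⟩ := Metric.eventually_nhds_iff_ball.1 h2
  refine ⟨min r₁ (r₂ / (‖J‖ + η / 2)), by positivity, fun X hX w hw => ?_⟩
  obtain ⟨hw₁, hw₂⟩ := lt_min_iff.1 hw
  have hX0 : 0 < X := by linarith
  have hXc : (X : ℂ) ≠ 0 := by exact_mod_cast hX0.ne'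
  have hnorm : ‖(X : ℂ)⁻¹ • w‖ = X⁻¹ * ‖w‖ := by
    rw [norm_smul, norm_inv, Complex.norm_of_nonneg hX0.le]
  set z := (X : ℂ) • G ((X : ℂ)⁻¹ • w) with hz
  have hzJ : ‖z - J w‖ ≤ η / 2 * ‖w‖ := by
    have h := h1 ((X : ℂ)⁻¹ • w) (by
      rw [mem_ball_zero_iff, hnorm]
      exact (mul_le_of_le_one_left (norm_nonneg w) (inv_le_one_of_one_le₀ hX)).trans_lt hw₁)
    have hrw : z - J w = (X : ℂ) • (G ((X : ℂ)⁻¹ • w) - J ((X : ℂ)⁻¹ • w)) := by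
      rw [smul_sub, map_smul, smul_inv_smul₀ hXc]
    rw [hrw, norm_smul, Complex.norm_of_nonneg hX0.le]
    rw [hnorm] at h
    calc _ ≤ X * (η / 2 * (X⁻¹ * ‖w‖)) := by gcongr
      _ = _ := by field_simp
  have hzw : ‖z‖ ≤ (‖J‖ + η / 2) * ‖w‖ := by
    have := norm_add_le (z - J w) (J w)
    rw [sub_add_cancel] at this
    linarith [J.le_opNorm w]
  have hΦz := h2 z (by
    rw [mem_ball_zero_iff]
    rw [lt_div_iff₀ hL] at hw₂
    linarith)
  have hΦw : ‖Φ z - z‖ ≤ η / 2 * ‖w‖ :=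
    calc _ ≤ η / 2 / (‖J‖ + η / 2) * ‖z‖ := hΦz
      _ ≤ η / 2 / (‖J‖ + η / 2) * ((‖J‖ + η / 2) * ‖w‖) := by gcongr
      _ = _ := by field_simp
  have := norm_add_le (Φ z - z) (z - J w)
  rw [sub_add_sub_cancel] at this
  linarith

/-- A pair of functions on `ℂ × ℂ` with nonvanishing Jacobian determinant has invertible
derivative. -/
theorem exists_continuousLinearEquiv_of_jacobian_ne_zero {f g : ℂ × ℂ → ℂ} {p : ℂ × ℂ}
    (hf : DifferentiableAt ℂ f p) (hg : DifferentiableAt ℂ g p)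
    (hdet : deriv (fun a : ℂ => f (a, p.2)) p.1 * deriv (fun b : ℂ => g (p.1, b)) p.2
      - deriv (fun a : ℂ => g (a, p.2)) p.1 * deriv (fun b : ℂ => f (p.1, b)) p.2 ≠ 0) :
    ∃ J : (ℂ × ℂ) ≃L[ℂ] (ℂ × ℂ),
      HasFDerivAt (fun q => (f q, g q)) (J : ℂ × ℂ →L[ℂ] ℂ × ℂ) p := by
  have hfst : ∀ {h : ℂ × ℂ → ℂ}, DifferentiableAt ℂ h p →
      deriv (fun a : ℂ => h (a, p.2)) p.1 = fderiv ℂ h p (1, 0) := fun {h} hh =>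
    (hh.hasFDerivAt.comp_hasDerivAt (f := fun a : ℂ => (a, p.2)) p.1
      ((hasDerivAt_id p.1).prodMk (hasDerivAt_const p.1 p.2))).deriv
  have hsnd : ∀ {h : ℂ × ℂ → ℂ}, DifferentiableAt ℂ h p →
      deriv (fun b : ℂ => h (p.1, b)) p.2 = fderiv ℂ h p (0, 1) := fun {h} hh =>
    (hh.hasFDerivAt.comp_hasDerivAt (f := fun b : ℂ => (p.1, b)) p.2
      ((hasDerivAt_const p.2 p.1).prodMk (hasDerivAt_id p.2))).deriv
  rw [hfst hf, hfst hg, hsnd hf, hsnd hg] at hdet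
  have hlin : ∀ (L : ℂ × ℂ →L[ℂ] ℂ) (u v : ℂ), L (u, v) = u * L (1, 0) + v * L (0, 1) := by
    intro L u v
    rw [← smul_eq_mul, ← smul_eq_mul, ← map_smul, ← map_smul, ← map_add]
    simp
  set L := (fderiv ℂ f p).prod (fderiv ℂ g p) with hL
  have hker : L.ker = ⊥ := by
    refine (Submodule.eq_bot_iff _).2 fun ⟨u, v⟩ huv => ?_
    obtain ⟨h1, h2⟩ := Prod.mk.inj
      (show (fderiv ℂ f p (u, v), fderiv ℂ g p (u, v)) = (0, 0) from huv)
    rw [hlin] at h1 h2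
    refine Prod.ext (mul_left_cancel₀ hdet ?_) (mul_left_cancel₀ hdet ?_)
    · simp only [Prod.fst_zero]
      linear_combination fderiv ℂ g p (0, 1) * h1 - fderiv ℂ f p (0, 1) * h2
    · simp only [Prod.snd_zero]
      linear_combination fderiv ℂ f p (1, 0) * h2 - fderiv ℂ g p (1, 0) * h1
  refine ⟨.ofBijective L hker (LinearMap.ker_eq_bot_iff_range_eq_top.1 hker), ?_⟩
  rw [ContinuousLinearEquiv.coe_ofBijective]
  exact hf.hasFDerivAt.prodMk hg.hasFDerivAt

theorem tendsto_two_mul_add_one_div_rpow (p : ℝ) :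
    Tendsto (fun k : ℕ => ((2 * (k : ℝ) + 1) / k) ^ p) atTop (𝓝 ((2 : ℝ) ^ p)) := by
  have h : Tendsto (fun k : ℕ => 2 + (k : ℝ)⁻¹) atTop (𝓝 (2 + 0)) :=
    tendsto_const_nhds.add (tendsto_inv_atTop_zero.comp tendsto_natCast_atTop_atTop)
  rw [add_zero] at h
  refine (h.rpow_const (Or.inl two_ne_zero)).congr' ?_
  filter_upwards [eventually_gt_atTop 0] with k hk
  have : (k : ℝ) ≠ 0 := by positivity
  congr 1
  field_simp

theorem eventually_rpow_mul_rpow_eq (p q : ℝ) :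
    (fun k : ℕ => (k : ℝ) ^ (p - q) * ((2 * (k : ℝ) + 1) / k) ^ p) =ᶠ[atTop]
      fun k : ℕ => (2 * (k : ℝ) + 1) ^ p * (k : ℝ) ^ (-q) := by
  filter_upwards [eventually_gt_atTop 0] with k hk
  have hk' : (0 : ℝ) < k := by exact_mod_cast hk
  rw [Real.div_rpow (by positivity) hk'.le, sub_eq_add_neg, Real.rpow_add hk']
  have := (Real.rpow_pos_of_pos hk' p).ne'
  field_simp

theorem tendsto_rpow_mul_rpow_neg_zero {p q : ℝ} (h : p < q) :
    Tendsto (fun k : ℕ => (2 * (k : ℝ) + 1) ^ p * (k : ℝ) ^ (-q)) atTop (𝓝 0) := by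
  refine Tendsto.congr' (eventually_rpow_mul_rpow_eq p q) ?_
  have h1 : Tendsto (fun k : ℕ => (k : ℝ) ^ (p - q)) atTop (𝓝 0) := by
    simpa [Function.comp_def] using
      (tendsto_rpow_neg_atTop (sub_pos.2 h)).comp (tendsto_natCast_atTop_atTop (R := ℝ))
  simpa using h1.mul (tendsto_two_mul_add_one_div_rpow p)

theorem tendsto_rpow_mul_rpow_neg_atTop {p q : ℝ} (h : q < p) :
    Tendsto (fun k : ℕ => (2 * (k : ℝ) + 1) ^ p * (k : ℝ) ^ (-q)) atTop atTop := by
  refine Tendsto.congr' (eventually_rpow_mul_rpow_eq p q) ?_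
  exact ((tendsto_rpow_atTop (sub_pos.2 h)).comp tendsto_natCast_atTop_atTop).atTop_mul_pos
    (by positivity) (tendsto_two_mul_add_one_div_rpow p)

/-- `exp` of an odd multiple of `iπ`. -/
theorem Complex.exp_odd_mul_I_pi (j l : ℕ) :
    Complex.exp ((2 * (j : ℂ) + 1) * (Complex.I * Real.pi * (2 * (l : ℂ) - 1))) = -1 := by
  have h : (2 * (j : ℂ) + 1) * (Complex.I * Real.pi * (2 * (l : ℂ) - 1))
      = Real.pi * Complex.I + ((2 * j * l + l - j - 1 : ℤ) : ℂ) * (2 * Real.pi * Complex.I) := by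
    push_cast
    ring
  rw [h, Complex.exp_add, Complex.exp_int_mul_two_pi_mul_I, Complex.exp_pi_mul_I, mul_one]

theorem hasFDerivAt_exp_sub_one_prod :
    HasFDerivAt (fun z : ℂ × ℂ => (Complex.exp z.1 - 1, Complex.exp z.2 - 1))
      (ContinuousLinearMap.id ℂ (ℂ × ℂ)) 0 := by
  have h1 : HasFDerivAt (fun z : ℂ × ℂ => Complex.exp z.1 - 1)
      (ContinuousLinearMap.fst ℂ ℂ ℂ) 0 := by
    simpa using ((hasFDerivAt_fst (𝕜 := ℂ) (p := (0 : ℂ × ℂ))).cexp).sub_const 1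
  have h2 : HasFDerivAt (fun z : ℂ × ℂ => Complex.exp z.2 - 1)
      (ContinuousLinearMap.snd ℂ ℂ ℂ) 0 := by
    simpa using ((hasFDerivAt_snd (𝕜 := ℂ) (p := (0 : ℂ × ℂ))).cexp).sub_const 1
  exact h1.prodMk h2


/-- Main technical theorem (abstract form): let `χ₂, χ₋₂` be holomorphic,
(2,3)-homogeneous of weight 5/2 on `S`, satisfying the Legendre relation
`∂_a χ₂ ∂_b χ₋₂ − ∂_a χ₋₂ ∂_b χ₂ = −28πi`, and let `(a*, b*)` solve the
Bohr–Sommerfeld–Boutroux system `χ₂ = iπ(2n−1)`, `χ₋₂ = iπ(2m−1)`. Set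
`(a_k, b_k) = ((2k+1)^{4/5}a*, (2k+1)^{6/5}b*)` and `Ũ = (−e^{χ₂}−1, −e^{χ₋₂}−1)`.
If `U` is holomorphic on `E` and for all large `k` the closed polydisc of polyradius
`(k^{−α}ε, k^{−β}δ)` centered at `(a_k, b_k)` is contained in `E ∩ S` with
`‖U − Ũ‖ ≤ C(2k+1)^{−1}` there, then for all large `k` the corresponding open
polydisc contains exactly one zero of `U`. -/
theorem unique_zero_in_polydisc
    (ε δ α β : ℝ) (hε : 0 < ε) (hδ : 0 < δ)
    (hα : 1/5 < α) (hα' : α < 6/5) (hβ : -(1/5) < β) (hβ' : β < 4/5)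
    (S : Set (ℂ × ℂ)) (hS : IsOpen S)
    (χ₂ χneg2 : ℂ × ℂ → ℂ)
    (hχ₂ : DifferentiableOn ℂ χ₂ S) (hχneg2 : DifferentiableOn ℂ χneg2 S)
    (hmem : ∀ x : ℝ, 0 < x → ∀ p ∈ S, ((x:ℂ)^2 * p.1, (x:ℂ)^3 * p.2) ∈ S)
    (hhom₂ : ∀ x : ℝ, 0 < x → ∀ p ∈ S,
      χ₂ ((x:ℂ)^2 * p.1, (x:ℂ)^3 * p.2) = ((x ^ ((5:ℝ)/2) : ℝ) : ℂ) * χ₂ p)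
    (hhomneg2 : ∀ x : ℝ, 0 < x → ∀ p ∈ S,
      χneg2 ((x:ℂ)^2 * p.1, (x:ℂ)^3 * p.2) = ((x ^ ((5:ℝ)/2) : ℝ) : ℂ) * χneg2 p)
    (hleg : ∀ p ∈ S,
      deriv (fun a : ℂ => χ₂ (a, p.2)) p.1 * deriv (fun b : ℂ => χneg2 (p.1, b)) p.2
        - deriv (fun a : ℂ => χneg2 (a, p.2)) p.1 * deriv (fun b : ℂ => χ₂ (p.1, b)) p.2
      = -(28 * Real.pi * Complex.I))
    (astar bstar : ℂ) (hstar : (astar, bstar) ∈ S)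
    (n m : ℕ) (hn : 0 < n) (hm : 0 < m)
    (hq₂ : χ₂ (astar, bstar) = Complex.I * Real.pi * (2 * (n:ℂ) - 1))
    (hqneg2 : χneg2 (astar, bstar) = Complex.I * Real.pi * (2 * (m:ℂ) - 1))
    (ak bk : ℕ → ℂ)
    (hak : ∀ k : ℕ, ak k = (((2*(k:ℝ)+1) ^ ((4:ℝ)/5) : ℝ) : ℂ) * astar)
    (hbk : ∀ k : ℕ, bk k = (((2*(k:ℝ)+1) ^ ((6:ℝ)/5) : ℝ) : ℂ) * bstar)
    (Ut : ℂ × ℂ → ℂ × ℂ)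
    (hUt : ∀ p : ℂ × ℂ, Ut p = (-Complex.exp (χ₂ p) - 1, -Complex.exp (χneg2 p) - 1))
    (E : Set (ℂ × ℂ)) (hE : IsOpen E)
    (U : ℂ × ℂ → ℂ × ℂ) (hU : DifferentiableOn ℂ U E)
    (C : ℝ) (hC : 0 ≤ C) (K₀ : ℕ)
    (hK₀ : ∀ k : ℕ, K₀ ≤ k → ∀ p : ℂ × ℂ,
      ‖p.1 - ak k‖ ≤ (k:ℝ) ^ (-α) * ε → ‖p.2 - bk k‖ ≤ (k:ℝ) ^ (-β) * δ →
      p ∈ E ∩ S ∧ ‖U p - Ut p‖ ≤ C * (2*(k:ℝ)+1)⁻¹) :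
    ∃ K : ℕ, ∀ k : ℕ, K ≤ k →
      ∃! p : ℂ × ℂ,
        (‖p.1 - ak k‖ < (k:ℝ) ^ (-α) * ε ∧ ‖p.2 - bk k‖ < (k:ℝ) ^ (-β) * δ) ∧
        U p = 0 := by
  have hχ₂' := hχ₂.differentiableAt (hS.mem_nhds hstar)
  have hχneg2' := hχneg2.differentiableAt (hS.mem_nhds hstar)
  obtain ⟨J, hJ⟩ := exists_continuousLinearEquiv_of_jacobian_ne_zero hχ₂' hχneg2' (by
    rw [hleg _ hstar]
    simp [Real.pi_ne_zero])
  set P : ℂ × ℂ := (astar, bstar) with hP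
  set N := ‖(J.symm : ℂ × ℂ →L[ℂ] ℂ × ℂ)‖ with hN
  have hNpos : 0 < N := J.norm_symm_pos
  have hG : HasFDerivAt (fun w => (χ₂ (P + w) - χ₂ P, χneg2 (P + w) - χneg2 P))
      (J : ℂ × ℂ →L[ℂ] ℂ × ℂ) 0 := by
    have h : HasFDerivAt (fun q => (χ₂ q - χ₂ P, χneg2 q - χneg2 P))
        (J : ℂ × ℂ →L[ℂ] ℂ × ℂ) (P + 0) := by
      rw [add_zero]
      exact hJ.sub_const (χ₂ P, χneg2 P)
    exact h.comp (0 : ℂ × ℂ) ((hasFDerivAt_id (0 : ℂ × ℂ)).const_add P)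
  obtain ⟨r₁, hr₁, happ⟩ := exists_norm_comp_rescale_sub_le hG (by simp)
    hasFDerivAt_exp_sub_one_prod (by simp) (η := 1 / (16 * N)) (by positivity)
  obtain ⟨r₂, hr₂, hrS⟩ := Metric.isOpen_iff.1 hS P hstar
  have hev : ∀ᶠ k : ℕ in atTop, K₀ ≤ k ∧ 0 < k ∧
      (2 * (k : ℝ) + 1) ^ ((1 : ℝ) / 5) * (k : ℝ) ^ (-α) < min r₁ r₂ / ε ∧
      (2 * (k : ℝ) + 1) ^ (-(1 / 5) : ℝ) * (k : ℝ) ^ (-β) < min r₁ r₂ / δ ∧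
      64 * N * C / ε ≤ (2 * (k : ℝ) + 1) ^ ((6 : ℝ) / 5) * (k : ℝ) ^ (-α) ∧
      64 * N * C / δ ≤ (2 * (k : ℝ) + 1) ^ ((4 : ℝ) / 5) * (k : ℝ) ^ (-β) := by
    filter_upwards [eventually_ge_atTop K₀, eventually_gt_atTop 0,
      (tendsto_rpow_mul_rpow_neg_zero hα).eventually_lt_const
        (show 0 < min r₁ r₂ / ε by positivity),
      (tendsto_rpow_mul_rpow_neg_zero hβ).eventually_lt_const
        (show 0 < min r₁ r₂ / δ by positivity),
      (tendsto_rpow_mul_rpow_neg_atTop hα').eventually_ge_atTop (64 * N * C / ε),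
      (tendsto_rpow_mul_rpow_neg_atTop hβ').eventually_ge_atTop (64 * N * C / δ)]
      with k h1 h2 h3 h4 h5 h6
    exact ⟨h1, h2, h3, h4, h5, h6⟩
  obtain ⟨K, hK⟩ := eventually_atTop.1 hev
  refine ⟨K, fun k hk => ?_⟩
  obtain ⟨hkK₀, hk0, hα0, hβ0, hα1, hβ1⟩ := hK k hk
  replace hak := hak k
  replace hbk := hbk k
  replace hK₀ := hK₀ k hkK₀
  have hX0 : (0 : ℝ) < 2 * (k : ℝ) + 1 := by positivity
  have hpow : ∀ j : ℕ, (2 * (k : ℝ) + 1) ^ ((j : ℝ) / 5) =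
      ((2 * (k : ℝ) + 1) ^ ((1 : ℝ) / 5)) ^ j := by
    intro j
    rw [← Real.rpow_natCast, ← Real.rpow_mul hX0.le]
    congr 1
    ring
  have h4 := hpow 4
  have h5 := hpow 5
  have h6 := hpow 6
  norm_num at h4 h5 h6
  rw [Real.rpow_neg hX0.le] at hβ0
  rw [h4] at hβ1 hak
  rw [h6] at hα1 hbk
  have hspos : 0 < (2 * (k : ℝ) + 1) ^ ((1 : ℝ) / 5) := Real.rpow_pos_of_pos hX0 _
  have hXc : (((2 * (k : ℝ) + 1 : ℝ)) : ℂ) = 2 * (k : ℂ) + 1 := by push_cast; rfl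
  have hX1 : (1 : ℝ) ≤ 2 * (k : ℝ) + 1 := by linarith [Nat.cast_nonneg (α := ℝ) k]
  set X : ℝ := 2 * (k : ℝ) + 1 with hX
  generalize X ^ ((1 : ℝ) / 5) = s at *
  have hA : 0 < (k : ℝ) ^ (-α) := Real.rpow_pos_of_pos (by exact_mod_cast hk0) _
  have hB : 0 < (k : ℝ) ^ (-β) := Real.rpow_pos_of_pos (by exact_mod_cast hk0) _
  generalize (k : ℝ) ^ (-α) = A at *
  generalize (k : ℝ) ^ (-β) = B at *
  generalize ak k = a at *
  generalize bk k = b at *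
  have hsc : (s : ℂ) ≠ 0 := by exact_mod_cast hspos.ne'
  have hX5 : (X : ℂ) = (s : ℂ) ^ 5 := by rw [h5]; push_cast; rfl
  have hs52 : (s ^ 2) ^ ((5 : ℝ) / 2) = X := by
    rw [h5, ← Real.rpow_natCast s 2, ← Real.rpow_mul hspos.le, ← Real.rpow_natCast s 5]
    norm_num
  have hscale : ∀ w : ℂ × ℂ, ((((s ^ 2 : ℝ)) : ℂ) ^ 2 * (P + (X : ℂ)⁻¹ • w).1,
      (((s ^ 2 : ℝ)) : ℂ) ^ 3 * (P + (X : ℂ)⁻¹ • w).2) = (a + (s : ℂ)⁻¹ * w.1, b + s * w.2) := by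
    intro w
    rw [hak, hbk, hX5]
    simp only [hP, Prod.fst_add, Prod.snd_add, Prod.smul_fst, Prod.smul_snd, smul_eq_mul]
    push_cast
    ext <;> (simp only []; field_simp)
  set σ : ℂ × ℂ → ℂ × ℂ := fun w => (a + (s : ℂ)⁻¹ * w.1, b + s * w.2) with hσ
  set V : Set (ℂ × ℂ) := {w | ‖w.1‖ < s * (A * ε) ∧ ‖w.2‖ < s⁻¹ * (B * δ)} with hV
  have hVr : ∀ w ∈ V, ‖w‖ < min r₁ r₂ := by
    rintro w ⟨hw1, hw2⟩
    rw [lt_div_iff₀ hε] at hα0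
    rw [lt_div_iff₀ hδ] at hβ0
    exact max_lt (by linarith) (by linarith)
  have hσ1 : ∀ w, ‖(σ w).1 - a‖ = s⁻¹ * ‖w.1‖ := by
    intro w
    simp [hσ, abs_of_pos hspos]
  have hσ2 : ∀ w, ‖(σ w).2 - b‖ = s * ‖w.2‖ := by
    intro w
    simp [hσ, abs_of_pos hspos]
  have hmemV : ∀ w, w ∈ V ↔ ‖(σ w).1 - a‖ < A * ε ∧ ‖(σ w).2 - b‖ < B * δ := by
    intro w
    rw [hσ1, hσ2, inv_mul_lt_iff₀ hspos, ← lt_inv_mul_iff₀ hspos]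
    rfl
  have hσV : ∀ w ∈ V, σ w ∈ E ∩ S ∧ ‖U (σ w) - Ut (σ w)‖ ≤ C * X⁻¹ := fun w hw =>
    hK₀ _ ((hmemV w).1 hw).1.le ((hmemV w).1 hw).2.le
  have hexp₂ : Complex.exp (X * χ₂ P) = -1 := by rw [hq₂, hXc, Complex.exp_odd_mul_I_pi]
  have hexpneg2 : Complex.exp (X * χneg2 P) = -1 := by
    rw [hqneg2, hXc, Complex.exp_odd_mul_I_pi]
  have hUtσ : ∀ w ∈ V, ‖Ut (σ w) - J w‖ ≤ 1 / (16 * N) * ‖w‖ := by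
    intro w hw
    obtain ⟨hw1, hw2⟩ := lt_min_iff.1 (hVr w hw)
    have hPw : P + (X : ℂ)⁻¹ • w ∈ S := hrS (by
      rw [mem_ball_iff_norm, add_sub_cancel_left, norm_smul, norm_inv,
        Complex.norm_of_nonneg hX0.le]
      exact (mul_le_of_le_one_left (norm_nonneg w) (inv_le_one_of_one_le₀ hX1)).trans_lt hw2)
    have e1 := hhom₂ (s ^ 2) (by positivity) _ hPw
    have e2 := hhomneg2 (s ^ 2) (by positivity) _ hPw
    rw [hscale, hs52] at e1 e2
    refine le_of_eq_of_le ?_ (happ X hX1 w hw1)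
    congr 2
    rw [hUt, e1, e2]
    simp only [Prod.smul_mk, smul_eq_mul, mul_sub, Complex.exp_sub, hexp₂, hexpneg2, div_neg,
      div_one]
  obtain ⟨w, ⟨hwV, hw0⟩, hwu⟩ := existsUnique_zero_of_norm_sub_le J (V := fun w => U (σ w)) (B := V)
    (ρ := min (s * (A * ε)) (s⁻¹ * (B * δ))) (η := 1 / (16 * N)) (τ := C * X⁻¹)
    (by positivity) (by positivity) (by positivity)
    (fun w hw => by
      rw [mem_ball_zero_iff, lt_min_iff] at hw
      exact ⟨(norm_fst_le w).trans_lt hw.1, (norm_snd_le w).trans_lt hw.2⟩)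
    (by
      refine hU.comp (Differentiable.differentiableOn (by fun_prop)) fun w hw => ?_
      rw [mem_ball_zero_iff, lt_min_iff] at hw
      exact (hσV w ⟨(norm_fst_le w).trans_lt hw.1, (norm_snd_le w).trans_lt hw.2⟩).1.1)
    (fun w hw => by
      have := norm_add_le (U (σ w) - Ut (σ w)) (Ut (σ w) - J w)
      rw [sub_add_sub_cancel] at this
      linarith [hUtσ w hw, (hσV w hw).2])
    (le_of_eq (by rw [← hN]; field_simp))
    (by
      rw [← hN, h5]
      rw [div_le_iff₀ hε] at hα1
      rw [div_le_iff₀ hδ] at hβ1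
      rw [le_div_iff₀ (by norm_num)]
      refine le_min ?_ ?_ <;> (field_simp; linarith))
  refine ⟨σ w, ⟨(hmemV w).1 hwV, hw0⟩, fun p ⟨hp, hp0⟩ => ?_⟩
  have hpσ : σ (s * (p.1 - a), (s : ℂ)⁻¹ * (p.2 - b)) = p := by
    simp [hσ, hsc]
  rw [← hpσ] at hp hp0 ⊢
  rw [hwu _ ⟨(hmemV _).2 hp, hp0⟩]
end
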